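/- arXiv:2406.03960 — 4 statements merged into one kernel-verified Lean document; each statement's English description precedes it below -/
import Mathlib

section
/- Let n and m be nonzero coprime integers and let p be a prime dividing n·m. Then for every representation of BS(n,m) on a finite abelian group M whose cardinality is a power of p, the second group cohomology H²(BS(n,m), M) is trivial (a subsingleton). -/
/-- The single relator `a^n t a^{-m} t⁻¹` of the Baumslag–Solitar group `BS(n,m)`,
with generator `0 = a` and `1 = t`. -/
def BSRel (n m : ℤ) : Set (FreeGroup (Fin 2)) :=
  {FreeGroup.of 0 ^ n * FreeGroup.of 1 * FreeGroup.of 0 ^ (-m) * (FreeGroup.of 1)⁻¹}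

/-- The Baumslag–Solitar group `BS(n,m) = ⟨a, t ∣ a^n = t a^m t⁻¹⟩`. -/
abbrev BS (n m : ℤ) := PresentedGroup (BSRel n m)

/-- The first generator `a` of `BS(n,m)`. -/
abbrev BS.a (n m : ℤ) : BS n m := PresentedGroup.of 0

/-- If `α^n` and `α^m` are conjugate with `n, m` coprime then the order of `α` is prime to `n`. -/
theorem BSaux_coprime {H : Type*} [Group H] [Finite H] (n m : ℤ) (hcop : IsCoprime n m)
    (α τ : H) (h : α ^ n = τ * α ^ m * τ⁻¹) : IsCoprime (orderOf α : ℤ) n := by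
  rw [Int.isCoprime_iff_gcd_eq_one]
  by_contra hg
  obtain ⟨q, hq, hqd⟩ := Nat.exists_prime_and_dvd hg
  have hq1 : (q : ℤ) ∣ orderOf α := (Int.natCast_dvd_natCast.2 hqd).trans (Int.gcd_dvd_left ..)
  have hq2 : (q : ℤ) ∣ n := (Int.natCast_dvd_natCast.2 hqd).trans (Int.gcd_dvd_right ..)
  obtain ⟨k, hk⟩ := hq1
  obtain ⟨l, hl⟩ := hq2
  have h1 : (α ^ n) ^ k = 1 := by
    rw [← zpow_mul, ← orderOf_dvd_iff_zpow_eq_one, hk, hl]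
    exact ⟨l, by ring⟩
  rw [h, conj_zpow, ← zpow_mul] at h1
  have h2 : α ^ (m * k) = 1 := by
    have := mul_inv_eq_one.1 h1
    simpa using this
  rw [← orderOf_dvd_iff_zpow_eq_one, hk] at h2
  have hk0 : k ≠ 0 := by
    rintro rfl
    have := orderOf_pos α
    rw [mul_zero] at hk
    omega
  have h3 : (q : ℤ) ∣ m := Int.dvd_of_mul_dvd_mul_right hk0 h2
  have h4 := hcop.isUnit_of_dvd' ⟨l, hl⟩ h3
  have := (Nat.prime_iff_prime_int.1 hq).not_isUnit
  exact this h4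

theorem BSaux_fix {H M : Type*} [Group H] [MulAction H M] (β : H) (j : ℤ) (x : M)
    (hx : β • x = x) : (β ^ j) • x = x :=
  (MulAction.stabilizer H x).zpow_mem (x := β) hx j

theorem BSaux_range {H M : Type*} [Group H] [AddCommGroup M] [DistribMulAction H M]
    (β : H) (j : ℕ) (z : M) : ∃ y, β • y - y = (β ^ j) • z - z := by
  induction j with
  | zero => exact ⟨0, by simp⟩
  | succ j ih =>
    obtain ⟨y, hy⟩ := ih
    refine ⟨y + (β ^ j) • z, ?_⟩
    rw [pow_succ', mul_smul, smul_add, ← sub_add_sub_cancel _ ((β ^ j) • z) z, ← hy]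
    abel

theorem BSaux_rangeZ {H M : Type*} [Group H] [AddCommGroup M] [DistribMulAction H M]
    (β : H) (j : ℤ) (z : M) : ∃ y, β • y - y = (β ^ j) • z - z := by
  obtain ⟨j, rfl | rfl⟩ := j.eq_nat_or_neg
  · simpa using BSaux_range β j z
  · obtain ⟨y, hy⟩ := BSaux_range β j ((β ^ (-(j : ℤ))) • z)
    refine ⟨-y, ?_⟩
    have : (β ^ j) • ((β ^ (-(j : ℤ))) • z) = z := by
      rw [← mul_smul, zpow_neg, zpow_natCast, mul_inv_cancel, one_smul]
    rw [this] at hy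
    rw [smul_neg, ← neg_sub z, ← hy]; abel

theorem BSaux_module (n m : ℤ) (hcop : IsCoprime n m)
    (p : ℕ) (hp : p.Prime) (hdvd : (p : ℤ) ∣ n * m)
    {H M : Type*} [Group H] [Finite H] [AddCommGroup M] [Finite M]
    [DistribMulAction H M] (hcard : ∃ k : ℕ, Nat.card M = p ^ k)
    (α τ : H) (h : α ^ n = τ * α ^ m * τ⁻¹) (c : M) :
    ∃ x y : M, α • x = x ∧ (α ^ n) • y - y + c + n • x - m • τ • x = 0 := by
  obtain ⟨K, hK⟩ := hcard
  have hc1 := BSaux_coprime n m hcop α τ h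
  have hc2 := BSaux_coprime m n hcop.symm α τ⁻¹ (by rw [h]; group)
  have hpi := Nat.prime_iff_prime_int.1 hp
  set k := orderOf α with hkdef
  have hpk : IsCoprime (k : ℤ) (p : ℤ) := by
    rcases hpi.dvd_or_dvd hdvd with hd | hd
    · exact hc1.of_isCoprime_of_dvd_right hd
    · exact hc2.of_isCoprime_of_dvd_right hd
  have hpK : ∀ x : M, ((p : ℤ) ^ K) • x = 0 := by
    intro x
    have : (Nat.card M) • x = 0 := card_nsmul_eq_zero'
    rw [hK] at this
    exact_mod_cast this
  have hαk : α ^ k = 1 := pow_orderOf_eq_one α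
  -- `α` is a power of `α ^ n`
  obtain ⟨u, v, huv⟩ := hc1
  have hαn : (α ^ n) ^ v = α := by
    rw [← zpow_mul]
    have : n * v = 1 - k * u := by linarith
    rw [this, zpow_sub, zpow_mul, zpow_natCast, hαk]; simp
  -- the fixed points
  let F : AddSubgroup M :=
    { carrier := {x | α • x = x}
      zero_mem' := by simp
      add_mem' := by
        intro a b ha hb
        simp only [Set.mem_ofPred_eq] at *
        rw [smul_add, ha, hb]
      neg_mem' := by
        intro a ha
        simp only [Set.mem_ofPred_eq] at *
        rw [smul_neg, ha] }
  have hτF : ∀ x ∈ F, τ • x ∈ F := by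
    intro x hx
    change α • τ • x = τ • x
    have h1 : (α ^ n) • τ • x = τ • x := by
      rw [h, mul_smul, mul_smul, inv_smul_smul, BSaux_fix α m x hx]
    have h2 := BSaux_fix (α ^ n) v _ h1
    rwa [hαn] at h2
  let f : F →+ F :=
    { toFun := fun x => ⟨n • x.1 - m • τ • x.1,
        F.sub_mem (F.zsmul_mem x.2 n) (F.zsmul_mem (hτF _ x.2) m)⟩
      map_zero' := by ext; simp
      map_add' := by
        intro x y
        ext
        simp only [AddSubgroup.coe_add, smul_add]
        abel }
  -- `p`-torsion cancellation
  have hcancel : ∀ (q : ℤ), IsCoprime q (p : ℤ) → ∀ x : M, q • x = 0 → x = 0 := by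
    intro q hq x hx
    obtain ⟨a, b, hab⟩ := hq.pow_right (n := K)
    rw [← one_zsmul x, ← hab, add_smul, mul_smul, mul_smul, hx, hpK]
    simp
  have hpow : ∀ (q : ℤ), (p : ℤ) ∣ q → ∀ x : M, (q ^ K) • x = 0 := by
    intro q hq x
    obtain ⟨r, hr⟩ := pow_dvd_pow_of_dvd hq K
    rw [hr, mul_smul, hpK]
  have hinj : Function.Injective f := by
    rw [injective_iff_map_eq_zero]
    intro x hx
    have hx' : n • x.1 = m • τ • x.1 := by
      have := congrArg Subtype.val hx
      exact sub_eq_zero.1 this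
    have hiter : ∀ j : ℕ, (n ^ j) • x.1 = (m ^ j) • (τ ^ j) • x.1 := by
      intro j
      induction j with
      | zero => simp
      | succ j ih =>
        rw [pow_succ, mul_comm, mul_smul, ih, smul_comm n, smul_comm n, hx',
          smul_comm (τ ^ j) m, ← mul_smul (τ ^ j), ← pow_succ, ← mul_smul, ← pow_succ]
    have hit := hiter K
    ext
    rcases hpi.dvd_or_dvd hdvd with hd | hd
    · rw [hpow n hd] at hit
      have hmp : IsCoprime m (p : ℤ) := hcop.symm.of_isCoprime_of_dvd_right hd
      have h3 := hcancel (m ^ K) hmp.pow_left _ hit.symm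
      simpa using (smul_eq_zero_iff_eq (τ ^ K)).1 h3
    · rw [hpow m hd] at hit
      have hmp : IsCoprime n (p : ℤ) := hcop.of_isCoprime_of_dvd_right hd
      exact hcancel (n ^ K) hmp.pow_left _ hit
  have hsurj : Function.Surjective f := Finite.surjective_of_injective hinj
  -- decompose `c`
  obtain ⟨a, b, hab⟩ := hpk.pow_right (n := K)
  have hNk : ∀ z : M, ∃ y ∈ F, ∃ w : M, α • w - w = y - (k : ℤ) • z := by
    intro z
    refine ⟨∑ i ∈ Finset.range k, (α ^ i) • z, ?_, ?_⟩
    · change α • (∑ i ∈ Finset.range k, (α ^ i) • z) = ∑ i ∈ Finset.range k, (α ^ i) • z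
      rw [Finset.smul_sum]
      simp only [← mul_smul, ← pow_succ']
      have e1 := Finset.sum_range_succ (fun i => (α ^ i) • z) k
      have e2 := Finset.sum_range_succ' (fun i => (α ^ i) • z) k
      simp only [hαk, pow_zero] at e1 e2
      exact add_right_cancel (e2.symm.trans e1)
    · choose w hw using fun i => BSaux_range α i z
      refine ⟨∑ i ∈ Finset.range k, w i, ?_⟩
      rw [Finset.smul_sum, ← Finset.sum_sub_distrib]
      simp [hw, Finset.sum_sub_distrib]
  obtain ⟨c0, hc0, w, hw⟩ := hNk (a • c)
  have hkc : (k : ℤ) • a • c = c := by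
    have : ((k : ℤ) * a) • c = (1 - b * p ^ K) • c := by rw [← hab]; ring_nf
    rw [← mul_smul, this, sub_smul, mul_smul, hpK]; simp
  rw [hkc] at hw
  obtain ⟨y, hy⟩ := BSaux_rangeZ (α ^ n) v w
  rw [hαn, hw] at hy
  obtain ⟨x, hx⟩ := hsurj ⟨-c0, F.neg_mem hc0⟩
  have hx' : n • x.1 - m • τ • x.1 = -c0 := congrArg Subtype.val hx
  refine ⟨x.1, y, x.2, ?_⟩
  rw [hy, add_sub_assoc, hx']
  abel

theorem BSaux_split (n m : ℤ) (hcop : IsCoprime n m)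
    (p : ℕ) (hp : p.Prime) (hdvd : (p : ℤ) ∣ n * m)
    {M E : Type*} [AddCommGroup M] [Finite M] (hcard : ∃ k : ℕ, Nat.card M = p ^ k)
    (ρ : Representation ℤ (BS n m) M) [Group E] (π : E →* BS n m)
    (hπ : Function.Surjective π) (i : M → E) (hi : ∀ x y, i (x + y) = i x * i y)
    (hπi : ∀ x, π (i x) = 1)
    (hker : ∀ e, π e = 1 → ∃ x, i x = e)
    (hconj : ∀ e x, e * i x = i (ρ (π e) x) * e) :
    ∃ s : BS n m →* E, ∀ g, π (s g) = g := by
  let H := (M →ₗ[ℤ] M)ˣ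
  have : Finite (M →ₗ[ℤ] M) := DFunLike.finite _
  have : Finite H := inferInstance
  let φ : BS n m →* H := ρ.asGroupHom
  have hφ : ∀ g x, φ g • x = ρ g x := fun g x => rfl
  let a : BS n m := PresentedGroup.of 0
  let t : BS n m := PresentedGroup.of 1
  have hrel : a ^ n * t * a ^ (-m) * t⁻¹ = 1 := by
    have := PresentedGroup.one_of_mem (rels := BSRel n m) (x := FreeGroup.of 0 ^ n *
      FreeGroup.of 1 * FreeGroup.of 0 ^ (-m) * (FreeGroup.of 1)⁻¹) rfl
    simp only [map_mul, map_zpow, map_inv] at this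
    exact this
  have hrel' : a ^ n = t * a ^ m * t⁻¹ := by
    rw [mul_inv_eq_one] at hrel
    rw [zpow_neg, mul_inv_eq_iff_eq_mul] at hrel
    rw [eq_mul_inv_iff_mul_eq, hrel]
  obtain ⟨A, hA⟩ := hπ a
  obtain ⟨T, hT⟩ := hπ t
  obtain ⟨c, hc⟩ := hker (A ^ n * T * A ^ (-m) * T⁻¹) (by simpa [hA, hT] using hrel)
  obtain ⟨x, y, hx, hxy⟩ := BSaux_module n m hcop p hp hdvd hcard (φ a) (φ t)
    (by rw [← map_zpow, hrel']; simp) c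
  rw [← map_zpow] at hxy
  simp only [hφ] at hx hxy
  have hi0 : i 0 = 1 := by
    have := hi 0 0
    simpa using this
  let ih : Multiplicative M →* E :=
    { toFun := fun z => i z.toAdd
      map_one' := hi0
      map_mul' := fun z w => hi _ _ }
  have hiz : ∀ (j : ℤ) z, i (j • z) = i z ^ j := fun j z =>
    map_zpow ih (Multiplicative.ofAdd z) j
  have hineg : ∀ z, i (-z) = (i z)⁻¹ := fun z => map_inv ih (Multiplicative.ofAdd z)
  have hcomm : Commute (i x) A := by
    have := hconj A x
    rw [hA, hx] at this
    exact this.symm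
  have hE : (i x * A) ^ n * (i y * T) * (i x * A) ^ (-m) * (i y * T)⁻¹ = 1 := by
    rw [hcomm.mul_zpow, hcomm.mul_zpow, ← hiz, ← hiz]
    have e1 : A ^ n * i y = i (ρ (a ^ n) y) * A ^ n := by
      rw [hconj, map_zpow, hA]
    have e2 : A ^ n * T * A ^ (-m) = i c * T := by
      rw [hc]; group
    have e3 : T * i (-m • x) = i (-m • ρ t x) * T := by
      rw [hconj, hT, map_zsmul]
    have e4 : i (-m • x) * A ^ (-m) = A ^ (-m) * i (-m • x) := by
      rw [hiz]; exact (hcomm.zpow_zpow _ _).eq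
    calc _ = i (n • x) * (A ^ n * i y) * T * (i (-m • x) * A ^ (-m)) * (i y * T)⁻¹ := by
            simp only [mul_assoc]
      _ = i (n • x) * i (ρ (a ^ n) y) * (A ^ n * T * A ^ (-m)) * i (-m • x) * (i y * T)⁻¹ := by
            rw [e1, e4]; simp only [mul_assoc]
      _ = i (n • x) * i (ρ (a ^ n) y) * i c * (T * i (-m • x)) * (i y * T)⁻¹ := by
            rw [e2]; simp only [mul_assoc]
      _ = i (n • x) * i (ρ (a ^ n) y) * i c * i (-m • ρ t x) * i (-y) := by
            rw [e3, hineg]; group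
      _ = i 0 := by
            rw [← hi, ← hi, ← hi, ← hi]
            congr 1
            rw [← hxy, neg_smul]
            abel
      _ = 1 := hi0
  let s : BS n m →* E := PresentedGroup.toGroup (f := ![i x * A, i y * T]) (by
    intro r hr
    rw [BSRel, Set.mem_singleton_iff] at hr
    subst hr
    simpa using hE)
  refine ⟨s, fun g => ?_⟩
  have : π.comp s = MonoidHom.id _ := by
    apply PresentedGroup.ext
    intro j
    fin_cases j
    · simp [s, hπi, hA, a]
    · simp [s, hπi, hT, t]
  exact DFunLike.congr_fun this g

/-- The extension attached to a 2-cocycle. -/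
structure BSExt (G M : Type*) where
  fst : M
  snd : G

theorem BSExt_ext {G M : Type*} {x y : M} {g h : G} (h1 : x = y) (h2 : g = h) :
    (⟨x, g⟩ : BSExt G M) = ⟨y, h⟩ := by rw [h1, h2]

theorem BSaux_cocycle (n m : ℤ) (hcop : IsCoprime n m)
    (p : ℕ) (hp : p.Prime) (hdvd : (p : ℤ) ∣ n * m)
    {M : Type*} [AddCommGroup M] [Finite M] (hcard : ∃ k : ℕ, Nat.card M = p ^ k)
    (ρ : Representation ℤ (BS n m) M) (f : BS n m × BS n m → M)
    (hf : ∀ g h j, f (g * h, j) + f (g, h) = ρ g (f (h, j)) + f (g, h * j)) :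
    ∃ σ : BS n m → M, ∀ g h, ρ g (σ h) - σ (g * h) + σ g = f (g, h) := by
  let E := BSExt (BS n m) M
  have h1 : ∀ g, f (1, g) = f (1, 1) := by
    intro g
    have := hf 1 1 g
    simp at this
    exact this.symm
  have h2 : ∀ g, f (g, 1) = ρ g (f (1, 1)) := by
    intro g
    have := hf g 1 1
    simp at this
    exact this
  let _ : Mul E := ⟨fun e e' => ⟨e.1 + ρ e.2 e'.1 + f (e.2, e'.2), e.2 * e'.2⟩⟩
  let _ : One E := ⟨⟨-f (1, 1), 1⟩⟩
  let _ : Inv E := ⟨fun e => ⟨-f (1, 1) - f (e.2⁻¹, e.2) - ρ e.2⁻¹ e.1, e.2⁻¹⟩⟩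
  have hmul : ∀ e e' : E, e * e' = ⟨e.1 + ρ e.2 e'.1 + f (e.2, e'.2), e.2 * e'.2⟩ :=
    fun _ _ => rfl
  have hone : (1 : E) = ⟨-f (1, 1), 1⟩ := rfl
  have hinv : ∀ e : E, e⁻¹ = ⟨-f (1, 1) - f (e.2⁻¹, e.2) - ρ e.2⁻¹ e.1, e.2⁻¹⟩ := fun _ => rfl
  let _ : Group E := Group.ofLeftAxioms
    (by
      rintro ⟨x, g⟩ ⟨y, h⟩ ⟨z, j⟩
      simp only [hmul]
      refine BSExt_ext ?_ (mul_assoc ..)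
      simp only [map_add, map_mul, Module.End.mul_apply]
      have := hf g h j
      rw [← sub_eq_zero] at this ⊢
      rw [← this]
      abel)
    (by
      rintro ⟨x, g⟩
      simp only [hmul, hone]
      refine BSExt_ext ?_ (one_mul _)
      simp only [map_one, Module.End.one_apply, h1 g]
      abel)
    (by
      rintro ⟨x, g⟩
      simp only [hmul, hone, hinv]
      refine BSExt_ext ?_ (inv_mul_cancel _)
      abel)
  let π : E →* BS n m := { toFun := BSExt.snd, map_one' := rfl, map_mul' := fun _ _ => rfl }
  obtain ⟨s, hs⟩ := BSaux_split n m hcop p hp hdvd hcard ρ π (fun g => ⟨⟨0, g⟩, rfl⟩)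
    (fun x => ⟨x - f (1, 1), 1⟩)
    (by
      intro x y
      simp only [hmul]
      refine BSExt_ext ?_ (one_mul _).symm
      simp only [map_one, Module.End.one_apply]
      abel)
    (fun _ => rfl)
    (by
      rintro ⟨x, g⟩ hg
      change g = 1 at hg
      subst hg
      exact ⟨x + f (1, 1), by simp⟩)
    (by
      rintro ⟨x, g⟩ y
      change (_ : E) = (⟨ρ g y - f (1, 1), 1⟩ : E) * _
      simp only [hmul]
      refine BSExt_ext ?_ ((mul_one _).trans (one_mul _).symm)
      simp only [map_one, Module.End.one_apply, h1 g, h2 g, map_sub]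
      abel)
  have hs' : ∀ g, (s g).snd = g := hs
  refine ⟨fun g => -(s g).fst, fun g h => ?_⟩
  have := congrArg BSExt.fst (map_mul s g h)
  rw [hmul] at this
  simp only [hs'] at this
  simp only [this, map_neg]
  abel

/-- Paper's Lemma 3.5 (Vanishing) for a cycle of length one: if `n` and `m` are coprime
and `p` is a prime dividing `n·m`, then `H²(BS(n,m), M)` vanishes for every representation
of `BS(n,m)` on a finite abelian group `M` of `p`-power order. -/
theorem BS_H2_vanishes_of_coprime
    (n m : ℤ) (hn : n ≠ 0) (hm : m ≠ 0) (hcop : IsCoprime n m)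
    (p : ℕ) (hp : p.Prime) (hdvd : (p : ℤ) ∣ n * m)
    (M : Type) [AddCommGroup M] [Finite M] (hcard : ∃ k : ℕ, Nat.card M = p ^ k)
    (ρ : Representation ℤ (BS n m) M) :
    Subsingleton (groupCohomology (Rep.of ρ) 2) := by
  refine subsingleton_of_forall_eq 0 fun x => ?_
  induction x using groupCohomology.H2_induction_on with
  | h f =>
    rw [groupCohomology.H2π_eq_zero_iff]
    obtain ⟨σ, hσ⟩ := BSaux_cocycle n m hcop p hp hdvd hcard ρ f.1
      ((groupCohomology.mem_cocycles₂_iff (A := Rep.of ρ) f.1).1 f.2)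
    exact ⟨σ, funext fun gh => hσ gh.1 gh.2⟩
end

section
/- Let Γ = Γ((n_i),(m_i)) be a generalised Baumslag–Solitar group over a cycle of length s whose augmentation products n(Ξ) and m(Ξ) are coprime, and let p be a prime dividing n(Ξ)·m(Ξ). Then for every representation of Γ on a finite abelian group M whose cardinality is a power of p, the second group cohomology H²(Γ, M) is trivial (a subsingleton). -/
/-- The relators of a generalised Baumslag–Solitar group over a cycle of length `s`:
generators are `some i` (= `a_{i+1}`) for `i : Fin s` together with the stable letter
`none` (= `t`); the relator indexed by a non-final `i` is `a_i^{n_i} a_{i+1}^{-m_i}`,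
and the relator indexed by the final vertex is `t a_s^{n_s} t⁻¹ a_1^{-m_s}`. -/
def cycleRel (s : ℕ) (n m : Fin s → ℤ) (i : Fin s) : FreeGroup (Option (Fin s)) :=
  if h : (i : ℕ) + 1 < s then
    FreeGroup.of (some i) ^ (n i) * FreeGroup.of (some ⟨(i : ℕ) + 1, h⟩) ^ (-(m i))
  else
    FreeGroup.of none * FreeGroup.of (some i) ^ (n i) * (FreeGroup.of none)⁻¹ *
      FreeGroup.of (some ⟨0, i.pos⟩) ^ (-(m i))

/-- The generalised Baumslag–Solitar group over a cycle of length `s`, with presentation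
`⟨a_1,…,a_s, t ∣ a_i^{n_i} = a_{i+1}^{m_i} (1 ≤ i ≤ s−1), t a_s^{n_s} t⁻¹ = a_1^{m_s}⟩`. -/
abbrev GBSCycle (s : ℕ) (n m : Fin s → ℤ) := PresentedGroup (Set.range (cycleRel s n m))

/-- The vertex generator `a_i` of the generalised Baumslag–Solitar group over a cycle. -/
abbrev GBSCycle.a (s : ℕ) (n m : Fin s → ℤ) (i : Fin s) : GBSCycle s n m :=
  PresentedGroup.of (some i)

section GeoSum

variable {G M : Type*} [Group G] [AddCommGroup M] [DistribMulAction G M]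

/-- The geometric sum `1 + g + ... + g^(n-1)` extended to integers `n`. -/
noncomputable def geoSum (g : G) : ℤ → M → M
  | Int.ofNat n, x => ∑ i ∈ Finset.range n, g ^ (i : ℤ) • x
  | Int.negSucc n, x => - ∑ i ∈ Finset.range (n + 1), g ^ (-((i : ℤ) + 1)) • x

theorem geoSum_zero (g : G) (x : M) : geoSum g 0 x = 0 := by
  change geoSum g (Int.ofNat 0) x = 0
  simp [geoSum]

theorem geoSum_add_one (g : G) (n : ℤ) (x : M) :
    geoSum g (n + 1) x = geoSum g n x + g ^ n • x := by
  rcases n with n | n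
  · change geoSum g (Int.ofNat (n + 1)) x = _
    simp only [geoSum, Finset.sum_range_succ]
    simp
  · rcases n with _ | n
    · change geoSum g 0 x = _
      rw [geoSum_zero]
      simp [geoSum]
    · change geoSum g (Int.negSucc n) x = _
      simp only [geoSum]
      rw [Finset.sum_range_succ _ (n + 1)]
      have : (Int.negSucc (n + 1)) = -(((n + 1 : ℕ) : ℤ) + 1) := by
        rw [Int.negSucc_eq]
      rw [this]
      abel

theorem geoSum_ind {P : ℤ → Prop} (h0 : P 0) (h1 : ∀ n, P n ↔ P (n + 1)) (n : ℤ) : P n := by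
  induction n using Int.induction_on with
  | zero => exact h0
  | succ i ih => exact (h1 _).1 ih
  | pred i ih => exact (h1 _).2 (by simpa using ih)

theorem geoSum_add (g : G) (n : ℤ) (x y : M) :
    geoSum g n (x + y) = geoSum g n x + geoSum g n y := by
  induction n using geoSum_ind with
  | h0 => simp [geoSum_zero]
  | h1 n =>
    simp only [geoSum_add_one, smul_add]
    rw [add_add_add_comm, add_left_inj]

theorem geoSum_smul_sub (g : G) (n : ℤ) (x : M) :
    g • geoSum g n x - geoSum g n x = g ^ n • x - x := by
  induction n using geoSum_ind with
  | h0 => simp [geoSum_zero]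
  | h1 n =>
    simp only [geoSum_add_one, smul_add, smul_smul, ← zpow_one_add]
    rw [add_comm 1 n]
    constructor
    · intro h
      rw [add_sub_add_comm, h]; abel
    · intro h
      rw [add_sub_add_comm] at h
      rw [← sub_eq_zero] at h ⊢
      rw [← h]; abel

theorem geoSum_smul (g : G) (n : ℤ) (x : M) : geoSum g n (g • x) = g • geoSum g n x := by
  induction n using geoSum_ind with
  | h0 => simp [geoSum_zero]
  | h1 n =>
    simp only [geoSum_add_one, smul_add, smul_smul, ← zpow_one_add, ← zpow_add_one]
    rw [add_comm 1 n, add_left_inj]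

theorem geoSum_map {Q : Type*} [AddCommGroup Q] (e : M →+ Q) (g : G)
    (h : ∀ x, e (g • x) = e x) (n : ℤ) (x : M) : e (geoSum g n x) = n • e x := by
  have hz : ∀ n : ℤ, e (g ^ n • x) = e x := by
    intro n
    induction n using geoSum_ind with
    | h0 => simp
    | h1 n => rw [add_comm, zpow_one_add, mul_smul, h]
  induction n using geoSum_ind with
  | h0 => simp [geoSum_zero]
  | h1 n => rw [geoSum_add_one, map_add, hz, add_zsmul, one_zsmul, add_left_inj]

/-- `geoSum` as an additive homomorphism. -/
noncomputable def geoHom (g : G) (n : ℤ) : M →+ M :=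
  AddMonoidHom.mk' (geoSum g n) (geoSum_add g n)

theorem zpow_zpow_of_coprime (g : G) (m : ℤ) (hc : (orderOf g).Coprime m.natAbs) :
    ∃ k : ℤ, (g ^ m) ^ k = g := by
  have : IsCoprime (orderOf g : ℤ) m := by
    rw [Int.isCoprime_iff_gcd_eq_one]; exact hc
  obtain ⟨a, b, hab⟩ := this
  refine ⟨b, ?_⟩
  rw [← zpow_mul]
  have : m * b = 1 - a * orderOf g := by linarith
  rw [this, zpow_sub, mul_comm a, zpow_mul]; simp

theorem smul_eq_of_zpow (g : G) (k : ℤ) (x : M) (h : g • x = x) : g ^ k • x = x := by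
  have : g ∈ MulAction.stabilizer G x := h
  exact Subgroup.zpow_mem _ this k

theorem coprime_zsmul_zero {p r : ℕ} (hp : p.Prime) (hM : ∀ x : M, (p ^ r) • x = 0)
    {m : ℤ} (hm : ¬ (p : ℤ) ∣ m) (x : M) (hx : m • x = 0) : x = 0 := by
  have : IsCoprime ((p : ℤ) ^ r) m :=
    IsCoprime.pow_left ((Nat.prime_iff_prime_int.1 hp).coprime_iff_not_dvd.2 hm)
  obtain ⟨a, b, hab⟩ := this
  have h2 : ((p : ℤ) ^ r) • x = 0 := by
    have := hM x
    rw [← natCast_zsmul] at this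
    exact_mod_cast this
  rw [← one_zsmul x, ← hab, add_zsmul, mul_zsmul, mul_zsmul, hx, h2]; simp

theorem coprime_zsmul_surj {p r : ℕ} (hp : p.Prime) (hM : ∀ x : M, (p ^ r) • x = 0)
    {m : ℤ} (hm : ¬ (p : ℤ) ∣ m) (x : M) : ∃ y : M, m • y = x := by
  have : IsCoprime ((p : ℤ) ^ r) m :=
    IsCoprime.pow_left ((Nat.prime_iff_prime_int.1 hp).coprime_iff_not_dvd.2 hm)
  obtain ⟨a, b, hab⟩ := this
  have h2 : ((p : ℤ) ^ r) • x = 0 := by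
    have := hM x
    rw [← natCast_zsmul] at this
    exact_mod_cast this
  refine ⟨b • x, ?_⟩
  rw [← mul_zsmul, mul_comm]
  conv_rhs => rw [← one_zsmul x, ← hab, add_zsmul, mul_zsmul, h2]
  simp

theorem geoSum_surj [Finite M] {p r : ℕ} (hp : p.Prime) (hM : ∀ x : M, (p ^ r) • x = 0)
    {m : ℤ} (hm : ¬ (p : ℤ) ∣ m) (g : G) (hc : (orderOf g).Coprime m.natAbs) (x : M) :
    ∃ y : M, geoSum g m y = x := by
  have hinj : Function.Injective (geoHom g m : M →+ M) := by
    rw [injective_iff_map_eq_zero]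
    intro x hx
    change geoSum g m x = 0 at hx
    have h1 := geoSum_smul_sub g m x
    rw [hx, smul_zero, sub_zero] at h1
    have h2 : g ^ m • x = x := (sub_eq_zero.1 h1.symm)
    obtain ⟨k, hk⟩ := zpow_zpow_of_coprime g m hc
    have h3 : g • x = x := by
      rw [← hk]; exact smul_eq_of_zpow _ k x h2
    have h4 : geoSum g m x = m • x := by
      clear hx h1 h2 hk hc hm
      induction m using geoSum_ind with
      | h0 => simp [geoSum_zero]
      | h1 n =>
        rw [geoSum_add_one, smul_eq_of_zpow g n x h3, add_zsmul, one_zsmul, add_left_inj]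
    exact coprime_zsmul_zero hp hM hm x (h4 ▸ hx)
  exact (Finite.injective_iff_surjective.1 hinj) x

end GeoSum

section Orders

variable {G ι : Type*} [Group G] [Finite G] [Fintype ι]

theorem factorization_orderOf_zpow (g : G) (n : ℤ) (hn : n ≠ 0) (q : ℕ) (hq : q.Prime) :
    (orderOf (g ^ n)).factorization q ≤ (orderOf g).factorization q ∧
    ((¬ (q : ℤ) ∣ n) → (orderOf (g ^ n)).factorization q = (orderOf g).factorization q) ∧
    ((q : ℤ) ∣ n → q ∣ orderOf g →
      (orderOf (g ^ n)).factorization q < (orderOf g).factorization q) := by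
  have ho : orderOf g ≠ 0 := (orderOf_pos g).ne'
  have e : orderOf (g ^ n) = orderOf g / (orderOf g).gcd n.natAbs := by
    have : orderOf (g ^ n) = orderOf (g ^ n.natAbs) := by
      rcases Int.natAbs_eq n with h | h
      · conv_lhs => rw [h, zpow_natCast]
      · conv_lhs => rw [h, zpow_neg, orderOf_inv, zpow_natCast]
    rw [this, orderOf_pow]
  have hd := Nat.gcd_dvd_left (orderOf g) n.natAbs
  have e2 : (orderOf (g ^ n)).factorization q
      = (orderOf g).factorization q - ((orderOf g).gcd n.natAbs).factorization q := by
    rw [e, Nat.factorization_div hd]; rfl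
  refine ⟨by omega, ?_, ?_⟩
  · intro h
    have : ((orderOf g).gcd n.natAbs).factorization q = 0 := by
      apply Nat.factorization_eq_zero_of_not_dvd
      intro h'
      exact h (Int.natCast_dvd.2 (h'.trans (Nat.gcd_dvd_right _ _)))
    omega
  · intro h h'
    have hg : (orderOf g).gcd n.natAbs ≠ 0 := Nat.gcd_ne_zero_left ho
    have h1 : 0 < ((orderOf g).gcd n.natAbs).factorization q :=
      hq.factorization_pos_of_dvd hg (Nat.dvd_gcd h' (Int.natCast_dvd.1 h))
    have h2 : 0 < (orderOf g).factorization q := hq.factorization_pos_of_dvd ho h'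
    omega

theorem cycle_order_coprime (σ : Equiv.Perm ι) (A U : ι → G) (n m : ι → ℤ)
    (hn : ∀ i, n i ≠ 0) (hm : ∀ i, m i ≠ 0) (hcop : ∀ i j, IsCoprime (n i) (m j))
    (hrel : ∀ i, U i * A i ^ n i * (U i)⁻¹ = A (σ i) ^ m i) (k : ι) :
    (orderOf (A (σ k))).Coprime (m k).natAbs := by
  apply Nat.Coprime.symm
  refine Nat.coprime_of_dvd fun q hq hqm hqo => ?_
  have hqm' : (q : ℤ) ∣ m k := Int.natCast_dvd.2 hqm
  have hqn : ∀ i, ¬ (q : ℤ) ∣ n i := fun i hi =>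
    (Nat.prime_iff_prime_int.1 hq).not_isUnit ((hcop i k).isUnit_of_dvd' hi hqm')
  have horder : ∀ i, orderOf (A i ^ n i) = orderOf (A (σ i) ^ m i) := by
    intro i
    rw [← hrel i, ← MulAut.conj_apply]
    exact (orderOf_injective (MulAut.conj (U i)).toMonoidHom (MulAut.conj (U i)).injective _).symm
  have hf : ∀ i, (orderOf (A i)).factorization q
      = (orderOf (A (σ i) ^ m i)).factorization q := fun i => by
    rw [← horder, (factorization_orderOf_zpow (A i) (n i) (hn i) q hq).2.1 (hqn i)]
  have hle : ∀ i, (orderOf (A i)).factorization q ≤ (orderOf (A (σ i))).factorization q :=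
    fun i => (hf i).trans_le (factorization_orderOf_zpow _ _ (hm i) q hq).1
  have hsum : ∑ i, (orderOf (A i)).factorization q = ∑ i, (orderOf (A (σ i))).factorization q :=
    (Equiv.sum_comp σ (fun i => (orderOf (A i)).factorization q)).symm
  have heq := (Finset.sum_eq_sum_iff_of_le (fun i _ => hle i)).1 hsum k (Finset.mem_univ k)
  have := (factorization_orderOf_zpow (A (σ k)) (m k) (hm k) q hq).2.2 hqm' hqo
  rw [← hf k] at this
  omega

theorem cycle_rel_reverse (σ : Equiv.Perm ι) (A U : ι → G) (n m : ι → ℤ)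
    (hrel : ∀ i, U i * A i ^ n i * (U i)⁻¹ = A (σ i) ^ m i) (j : ι) :
    (U (σ.symm j))⁻¹ * A j ^ m (σ.symm j) * ((U (σ.symm j))⁻¹)⁻¹
      = A (σ.symm j) ^ n (σ.symm j) := by
  have := hrel (σ.symm j)
  rw [Equiv.apply_symm_apply] at this
  rw [← this]; group

end Orders

section Solve

variable {G M ι : Type*} [Group G] [Finite G] [AddCommGroup M] [Finite M] [DistribMulAction G M]
  [Fintype ι] [DecidableEq ι]

theorem cycle_solve_left (σ : Equiv.Perm ι) (hσ : ∀ i j, ∃ k : ℕ, σ^[k] i = j) (i0 : ι)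
    (A U : ι → G) (n m : ι → ℤ)
    (hn : ∀ i, n i ≠ 0) (hm : ∀ i, m i ≠ 0) (hcop : ∀ i j, IsCoprime (n i) (m j))
    (hrel : ∀ i, U i * A i ^ n i * (U i)⁻¹ = A (σ i) ^ m i)
    {p r : ℕ} (hp : p.Prime) (hM : ∀ x : M, (p ^ r) • x = 0)
    (k : ι) (hk : (p : ℤ) ∣ n k) (b : ι → M) :
    ∃ (c : ι → M) (d : M), ∀ i, U i • geoSum (A i) (n i) (c i)
      - geoSum (A (σ i)) (m i) (c (σ i))
      + (if i = i0 then d - A (σ i) ^ m i • d else 0) = b i := by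
  have hpm : ∀ i, ¬ (p : ℤ) ∣ m i := fun i hi =>
    (Nat.prime_iff_prime_int.1 hp).not_isUnit ((hcop k i).isUnit_of_dvd' hk hi)
  have hcm : ∀ i, (orderOf (A (σ i))).Coprime (m i).natAbs :=
    cycle_order_coprime σ A U n m hn hm hcop hrel
  have hcn : ∀ i, (orderOf (A i)).Coprime (n i).natAbs := by
    intro i
    have := cycle_order_coprime σ.symm A (fun j => (U (σ.symm j))⁻¹) (fun j => m (σ.symm j))
      (fun j => n (σ.symm j)) (fun _ => hm _) (fun _ => hn _) (fun _ _ => (hcop _ _).symm)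
      (cycle_rel_reverse σ A U n m hrel) (σ i)
    simpa using this
  let φ : (ι → M) × M →+ (ι → M) := AddMonoidHom.mk' (fun cd i => U i • geoSum (A i) (n i) (cd.1 i)
      - geoSum (A (σ i)) (m i) (cd.1 (σ i))
      + (if i = i0 then cd.2 - A (σ i) ^ m i • cd.2 else 0)) (by
    intro x y
    funext i
    simp only [Prod.fst_add, Prod.snd_add, Pi.add_apply, geoSum_add, smul_add]
    split_ifs <;> abel)
  let e : ι → M →+ ((ι → M) ⧸ φ.range) := fun i =>
    (QuotientAddGroup.mk' φ.range).comp (AddMonoidHom.single (fun _ => M) i)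
  have gz : ∀ (g : G) (l : ℤ), geoSum g l (0 : M) = 0 := fun g l => (geoHom g l : M →+ M).map_zero
  -- the basic relations
  have R1 : ∀ j x, e j (geoSum (A (σ j)) (m j) x)
      = e (σ j) (U (σ j) • geoSum (A (σ j)) (n (σ j)) x) := by
    intro j x
    refine (QuotientAddGroup.eq).2 ⟨(Pi.single (σ j) x, 0), ?_⟩
    funext l
    simp only [φ, AddMonoidHom.mk'_apply, AddMonoidHom.single_apply, Pi.add_apply, Pi.neg_apply,
      smul_zero, sub_zero, ite_self, add_zero]
    by_cases h1 : l = σ j <;> by_cases h2 : l = j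
    · subst h2; rw [← h1]; simp; abel
    · subst h1
      have : σ (σ j) ≠ σ j := fun h => h2 (σ.injective h)
      simp [Pi.single_eq_of_ne this, Pi.single_eq_of_ne h2, gz]
    · subst h2
      simp [Pi.single_eq_of_ne h1, gz]
    · have : σ l ≠ σ j := fun h => h2 (σ.injective h)
      simp [Pi.single_eq_of_ne this, Pi.single_eq_of_ne h1, Pi.single_eq_of_ne h2, gz]
  have R2 : ∀ x, e i0 (A (σ i0) ^ m i0 • x) = e i0 x := by
    intro x
    refine (QuotientAddGroup.eq).2 ⟨(0, x), ?_⟩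
    funext l
    simp only [φ, AddMonoidHom.mk'_apply, AddMonoidHom.single_apply, Pi.add_apply, Pi.neg_apply,
      Pi.zero_apply, gz, smul_zero, sub_zero, zero_add]
    by_cases h : l = i0
    · subst h; simp; abel
    · simp [h]
  have ez : ∀ (i : ι) (g : G), (∀ x, e i (g • x) = e i x) → ∀ (l : ℤ) x,
      e i (g ^ l • x) = e i x := by
    intro i g h l x
    induction l using geoSum_ind with
    | h0 => simp
    | h1 l => rw [add_comm, zpow_one_add, mul_smul, h]
  -- invariance
  have conj : ∀ i, (∀ x, e i (A (σ i) • x) = e i x) → ∀ x, e i (U i • A i • x) = e i (U i • x) := by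
    intro i h x
    obtain ⟨l, hl⟩ := zpow_zpow_of_coprime (A i) (n i) (hcn i)
    have : U i * A i = (A (σ i)) ^ (m i * l) * U i := by
      rw [zpow_mul, ← hrel i, conj_zpow, hl]; group
    rw [smul_smul, this, mul_smul, ez i _ h]
  have Inv0 : ∀ x, e i0 (A (σ i0) • x) = e i0 x := by
    intro x
    obtain ⟨l, hl⟩ := zpow_zpow_of_coprime (A (σ i0)) (m i0) (hcm i0)
    conv_lhs => rw [← hl]
    exact ez i0 _ R2 l x
  have step : ∀ j, (∀ x, e (σ j) (A (σ (σ j)) • x) = e (σ j) x) →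
      ∀ x, e j (A (σ j) • x) = e j x := by
    intro j h x
    obtain ⟨y, rfl⟩ := geoSum_surj hp hM (hpm j) (A (σ j)) (hcm j) x
    rw [← geoSum_smul, R1, R1, geoSum_smul, conj _ h]
  have Inv : ∀ i x, e i (A (σ i) • x) = e i x := by
    intro i
    obtain ⟨l, hl⟩ := hσ i i0
    induction l generalizing i with
    | zero => intro x; simp at hl; subst hl; exact Inv0 x
    | succ l ih => exact step i (ih (σ i) (by simpa using hl))
  have main : ∀ j x, m j • e j x = n (σ j) • e (σ j) (U (σ j) • x) := by
    intro j x
    rw [← geoSum_map (e j) (A (σ j)) (Inv j), R1]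
    exact geoSum_map ((e (σ j)).comp (DistribSMul.toAddMonoidHom M (U (σ j)))) (A (σ j))
      (fun x => conj _ (Inv _) x) _ x
  have mono1 : ∀ j x, ∃ y, e j x = n (σ j) • e (σ j) y := by
    intro j x
    obtain ⟨y, rfl⟩ := coprime_zsmul_surj hp hM (hpm j) x
    exact ⟨U (σ j) • y, by rw [map_zsmul, main]⟩
  have mono : ∀ (l : ℕ) j x, ∃ y, e j x = e (σ^[l] j) y := by
    intro l
    induction l with
    | zero => exact fun j x => ⟨x, rfl⟩
    | succ l ih =>
      intro j x
      obtain ⟨y, hy⟩ := mono1 j x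
      obtain ⟨z, hz⟩ := ih (σ j) (n (σ j) • y)
      exact ⟨z, by rw [hy, ← map_zsmul, hz]; rfl⟩
  have all : ∀ i j x, ∃ y, e i x = e j y := by
    intro i j x
    obtain ⟨l, rfl⟩ := hσ i j
    exact mono l i x
  have hpk : ∀ x, ∃ y, e k x = p • e k y := by
    intro x
    obtain ⟨y, hy⟩ := all k (σ.symm k) x
    obtain ⟨z, hz⟩ := mono1 (σ.symm k) y
    rw [Equiv.apply_symm_apply] at hz
    obtain ⟨q, hq⟩ := hk
    refine ⟨q • z, ?_⟩
    rw [hy, hz, hq, mul_zsmul, map_zsmul, natCast_zsmul]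
  have hpr : ∀ (l : ℕ) x, ∃ y, e k x = (p ^ l) • e k y := by
    intro l
    induction l with
    | zero => exact fun x => ⟨x, by simp⟩
    | succ l ih =>
      intro x
      obtain ⟨y, hy⟩ := ih x
      obtain ⟨z, hz⟩ := hpk y
      exact ⟨z, by rw [hy, hz, pow_succ, mul_smul]⟩
  have hzero : ∀ i x, e i x = 0 := by
    intro i x
    obtain ⟨y, hy⟩ := all i k x
    obtain ⟨z, hz⟩ := hpr r y
    rw [hy, hz, ← map_nsmul, hM, map_zero]
  have hb : b ∈ φ.range := by
    rw [← Finset.univ_sum_single b]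
    exact AddSubgroup.sum_mem _ fun i _ => (QuotientAddGroup.eq_zero_iff _).1 (hzero i (b i))
  obtain ⟨cd, hcd⟩ := hb
  exact ⟨cd.1, cd.2, fun i => congrFun hcd i⟩

theorem cycle_solve (σ : Equiv.Perm ι) (hσ : ∀ i j, ∃ k : ℕ, σ^[k] i = j) (i0 : ι)
    (A U : ι → G) (n m : ι → ℤ)
    (hn : ∀ i, n i ≠ 0) (hm : ∀ i, m i ≠ 0) (hcop : ∀ i j, IsCoprime (n i) (m j))
    (hrel : ∀ i, U i * A i ^ n i * (U i)⁻¹ = A (σ i) ^ m i)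
    {p r : ℕ} (hp : p.Prime) (hM : ∀ x : M, (p ^ r) • x = 0)
    (k : ι) (hk : (p : ℤ) ∣ n k ∨ (p : ℤ) ∣ m k) (b : ι → M) :
    ∃ (c : ι → M) (d : M), ∀ i, U i • geoSum (A i) (n i) (c i)
      - geoSum (A (σ i)) (m i) (c (σ i))
      + (if i = i0 then d - A (σ i) ^ m i • d else 0) = b i := by
  rcases hk with hk | hk
  · exact cycle_solve_left σ hσ i0 A U n m hn hm hcop hrel hp hM k hk b
  · have hσ' : ∀ i j, ∃ k : ℕ, σ.symm^[k] i = j := by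
      intro i j
      obtain ⟨l, hl⟩ := hσ j i
      refine ⟨l, ?_⟩
      rw [← hl]
      exact (Function.LeftInverse.iterate σ.symm_apply_apply l) j
    obtain ⟨c, d, h⟩ := cycle_solve_left (M := M) σ.symm hσ' (σ i0) A
      (fun j => (U (σ.symm j))⁻¹) (fun j => m (σ.symm j))
      (fun j => n (σ.symm j)) (fun _ => hm _) (fun _ => hn _) (fun _ _ => (hcop _ _).symm)
      (cycle_rel_reverse σ A U n m hrel) hp hM (σ k) (by simpa using hk)
      (fun j => - ((U (σ.symm j))⁻¹ • b (σ.symm j)))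
    refine ⟨c, - (U i0 • d), fun i => ?_⟩
    have h1 := h (σ i)
    simp only [Equiv.symm_apply_apply, EmbeddingLike.apply_eq_iff_eq] at h1
    have h2 := congrArg (fun x => - (U i • x)) h1
    simp only [smul_neg, neg_neg, smul_inv_smul] at h2
    rw [← h2]
    by_cases h3 : i = i0
    · subst h3
      simp only [if_true, smul_add, smul_sub, smul_inv_smul, smul_neg]
      rw [← hrel i]
      simp only [mul_smul, inv_smul_smul]
      abel
    · simp only [h3, if_false, smul_add, smul_sub, smul_inv_smul, smul_zero]
      abel

end Solve

section Extension

variable {Γ G M : Type*} [Group Γ] [Group G] [AddCommGroup M] [DistribMulAction G M]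

/-- The underlying set of the extension of `Γ` by `M` attached to a 2-cocycle. -/
@[ext]
structure CocycleExt (φ : Γ →* G) (f : Γ × Γ → M)
    (hf : ∀ g h j, f (g * h, j) + f (g, h) = φ g • f (h, j) + f (g, h * j)) where
  /-- module component -/
  fst : M
  /-- group component -/
  snd : Γ

namespace CocycleExt

variable {φ : Γ →* G} {f : Γ × Γ → M}
  {hf : ∀ g h j, f (g * h, j) + f (g, h) = φ g • f (h, j) + f (g, h * j)}

instance : Mul (CocycleExt φ f hf) :=
  ⟨fun x y => ⟨x.fst + φ x.snd • y.fst + f (x.snd, y.snd), x.snd * y.snd⟩⟩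

instance : One (CocycleExt φ f hf) := ⟨⟨- f (1, 1), 1⟩⟩

instance : Inv (CocycleExt φ f hf) :=
  ⟨fun x => ⟨- f (1, 1) - φ x.snd⁻¹ • x.fst - f (x.snd⁻¹, x.snd), x.snd⁻¹⟩⟩

theorem mul_fst (x y : CocycleExt φ f hf) :
    (x * y).fst = x.fst + φ x.snd • y.fst + f (x.snd, y.snd) := rfl
theorem mul_snd (x y : CocycleExt φ f hf) : (x * y).snd = x.snd * y.snd := rfl
theorem one_fst : (1 : CocycleExt φ f hf).fst = - f (1, 1) := rfl
theorem one_snd : (1 : CocycleExt φ f hf).snd = 1 := rfl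
theorem inv_fst (x : CocycleExt φ f hf) :
    (x⁻¹).fst = - f (1, 1) - φ x.snd⁻¹ • x.fst - f (x.snd⁻¹, x.snd) := rfl
theorem inv_snd (x : CocycleExt φ f hf) : (x⁻¹).snd = x.snd⁻¹ := rfl

theorem f_one_left
    (hf : ∀ g h j, f (g * h, j) + f (g, h) = φ g • f (h, j) + f (g, h * j)) (h : Γ) : f (1, h) = f (1, 1) := by
  have := hf 1 1 h
  simp only [one_mul, map_one, one_smul] at this
  exact (add_left_cancel this).symm

theorem f_one_right
    (hf : ∀ g h j, f (g * h, j) + f (g, h) = φ g • f (h, j) + f (g, h * j)) (h : Γ) : f (h, 1) = φ h • f (1, 1) := by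
  have := hf h 1 1
  simp only [mul_one] at this
  exact add_right_cancel this

instance : Group (CocycleExt φ f hf) := Group.ofLeftAxioms
  (by
    intro x y z
    ext
    · simp only [mul_fst, mul_snd, smul_add, map_mul, mul_smul]
      have := hf x.snd y.snd z.snd
      rw [← sub_eq_zero] at this ⊢
      rw [← this]; abel
    · simp only [mul_snd, mul_assoc])
  (by
    intro x
    ext
    · simp only [mul_fst, one_fst, one_snd, map_one, one_smul, f_one_left (hf := hf) x.snd]; abel
    · simp [mul_snd, one_snd])
  (by
    intro x
    ext
    · simp only [mul_fst, one_fst, inv_fst, inv_snd]; abel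
    · simp [mul_snd, one_snd, inv_snd])

/-- the projection -/
def proj : CocycleExt φ f hf →* Γ where
  toFun := snd
  map_one' := rfl
  map_mul' _ _ := rfl

/-- the inclusion of the kernel -/
def incl (x : M) : CocycleExt φ f hf := ⟨x - f (1, 1), 1⟩

theorem incl_mul (x : M) (e : CocycleExt φ f hf) : incl x * e = ⟨x + e.fst, e.snd⟩ := by
  ext
  · simp only [mul_fst, incl, map_one, one_smul, f_one_left (hf := hf) e.snd]; abel
  · simp [mul_snd, incl]

theorem mul_incl (x : M) (e : CocycleExt φ f hf) : e * incl x = incl (φ (proj e) • x) * e := by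
  rw [incl_mul]
  ext
  · simp only [mul_fst, incl, smul_sub, f_one_right (hf := hf) e.snd, proj, MonoidHom.coe_mk,
      OneHom.coe_mk]
    abel
  · simp [mul_snd, incl]

theorem incl_add (x y : M) : (incl (x + y) : CocycleExt φ f hf) = incl x * incl y := by
  rw [incl_mul]
  ext
  · simp only [incl]; abel
  · rfl

theorem incl_zero : (incl 0 : CocycleExt φ f hf) = 1 := by
  ext
  · simp [incl, one_fst]
  · rfl

theorem incl_neg (x : M) : (incl (-x) : CocycleExt φ f hf) = (incl x)⁻¹ := by
  rw [eq_inv_iff_mul_eq_one, ← incl_add, neg_add_cancel, incl_zero]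

theorem proj_incl (x : M) : proj (incl x : CocycleExt φ f hf) = 1 := rfl

theorem exists_incl (e e' : CocycleExt φ f hf) (h : proj e = proj e') :
    ∃ b, incl b * e = e' := by
  refine ⟨e'.fst - e.fst, ?_⟩
  rw [incl_mul]
  ext
  · simp
  · exact h

theorem incl_mul_zpow (c : M) (α : CocycleExt φ f hf) (n : ℤ) :
    (incl c * α) ^ n = incl (geoSum (φ (proj α)) n c) * α ^ n := by
  induction n using geoSum_ind with
  | h0 => simp [geoSum_zero, incl_zero]
  | h1 n =>
    rw [zpow_add_one, zpow_add_one, geoSum_add_one, incl_add]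
    have : incl (geoSum (φ (proj α)) n c) * incl (φ (proj α) ^ n • c) * (α ^ n * α)
        = incl (geoSum (φ (proj α)) n c) * α ^ n * (incl c * α) := by
      have h := mul_incl c (α ^ n)
      rw [map_zpow, map_zpow] at h
      calc _ = incl (geoSum (φ (proj α)) n c) * (incl (φ (proj α) ^ n • c) * α ^ n) * α := by
            simp only [mul_assoc]
        _ = _ := by rw [← h]; simp only [mul_assoc]
    rw [this, mul_left_inj]

theorem rel_of_eq (W α β : CocycleExt φ f hf) (n m : ℤ) (b c c' d : M)
    (hb : incl b * (W * α ^ n * W⁻¹) = β ^ m)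
    (h : φ (proj W) • geoSum (φ (proj α)) n c - geoSum (φ (proj β)) m c'
      + (d - φ (proj β) ^ m • d) = b) :
    (incl d * W) * (incl c * α) ^ n * (incl d * W)⁻¹ = (incl c' * β) ^ m := by
  rw [incl_mul_zpow, incl_mul_zpow, ← hb]
  have hπ : proj (W * α ^ n * W⁻¹) = proj β ^ m := by
    rw [← map_zpow, ← hb, map_mul proj (incl b), proj_incl, one_mul]
  have h1 : incl d * W * (incl (geoSum (φ (proj α)) n c) * α ^ n) * (incl d * W)⁻¹
      = incl d * (W * incl (geoSum (φ (proj α)) n c)) * α ^ n * W⁻¹ * incl (-d) := by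
    rw [incl_neg]; group
  have h2 : incl d * (incl (φ (proj W) • geoSum (φ (proj α)) n c) * W) * α ^ n * W⁻¹ * incl (-d)
      = incl (d + φ (proj W) • geoSum (φ (proj α)) n c) * ((W * α ^ n * W⁻¹) * incl (-d)) := by
    rw [incl_add]; group
  rw [h1, mul_incl _ W, h2, mul_incl, hπ, map_zpow]
  generalize W * α ^ n * W⁻¹ = X
  rw [← mul_assoc, ← mul_assoc, ← incl_add, ← incl_add, ← h, smul_neg]
  congr 2
  abel

end CocycleExt

end Extension

section Presentation

variable (s : ℕ) (n m : Fin s → ℤ)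

/-- stable letter part -/
def cycleU {H : Type*} [Group H] {s : ℕ} (x : Option (Fin s) → H) (i : Fin s) : H :=
  if (i : ℕ) + 1 < s then 1 else x none

theorem cycleRel_lift {H : Type*} [Group H] (x : Option (Fin s) → H) (i : Fin s) :
    FreeGroup.lift x (cycleRel s n m i) = 1 ↔
      cycleU x i * x (some i) ^ n i * (cycleU x i)⁻¹ = x (some (finRotate s i)) ^ m i := by
  obtain _ | s := s
  · exact i.elim0
  by_cases h : (i : ℕ) + 1 < s + 1
  · have : finRotate (s + 1) i = ⟨(i : ℕ) + 1, h⟩ := by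
      have := finRotate_of_lt (n := s) (k := i) (by omega)
      simpa using this
    simp only [cycleRel, cycleU, dif_pos h, if_pos h, this, map_mul, map_zpow,
      map_inv,
      FreeGroup.lift_apply_of, zpow_neg, one_mul, inv_one, mul_one, mul_inv_eq_one]
  · have hi : i = Fin.last s := by ext; simp; omega
    have : finRotate (s + 1) i = ⟨0, i.pos⟩ := by
      subst hi; rw [finRotate_last]; rfl
    simp only [cycleRel, cycleU, dif_neg h, if_neg h, this, map_mul, map_zpow, map_inv,
      FreeGroup.lift_apply_of, zpow_neg, mul_inv_eq_one]

theorem finRotate_trans (i j : Fin s) : ∃ k : ℕ, (finRotate s)^[k] i = j := by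
  obtain _ | s := s
  · exact i.elim0
  have : ∀ k : ℕ, (finRotate (s + 1))^[k] i = i + Fin.ofNat (s + 1) k := by
    intro k
    induction k with
    | zero => ext; simp [Fin.val_add, Nat.mod_eq_of_lt]
    | succ k ih =>
      rw [Function.iterate_succ_apply', ih, finRotate_apply]
      ext
      simp [Fin.val_add, add_assoc]
  refine ⟨(j - i).val, ?_⟩
  rw [this, Fin.ofNat_val_eq_self]; simp

theorem GBSCycle_cocycle_split {G M : Type*} [Group G] [Finite G] [AddCommGroup M] [Finite M]
    [DistribMulAction G M] (hs : 0 < s)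
    (hn : ∀ i, n i ≠ 0) (hm : ∀ i, m i ≠ 0) (hcop : ∀ i j, IsCoprime (n i) (m j))
    {p r : ℕ} (hp : p.Prime) (hM : ∀ x : M, (p ^ r) • x = 0)
    (k : Fin s) (hk : (p : ℤ) ∣ n k ∨ (p : ℤ) ∣ m k)
    (φ : GBSCycle s n m →* G) (f : GBSCycle s n m × GBSCycle s n m → M)
    (hf : ∀ g h j, f (g * h, j) + f (g, h) = φ g • f (h, j) + f (g, h * j)) :
    ∃ y : GBSCycle s n m → M, ∀ g h, φ g • y h - y (g * h) + y g = f (g, h) := by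
  let i0 : Fin s := ⟨s - 1, by omega⟩
  have hi0 : ∀ i : Fin s, i = i0 ↔ ¬ ((i : ℕ) + 1 < s) := by
    intro i
    simp only [i0, Fin.ext_iff]
    omega
  let x : Option (Fin s) → GBSCycle s n m := PresentedGroup.of
  have hx : ∀ i, cycleU x i * x (some i) ^ n i * (cycleU x i)⁻¹
      = x (some (finRotate s i)) ^ m i := by
    intro i
    rw [← cycleRel_lift]
    have : FreeGroup.lift x = PresentedGroup.mk (Set.range (cycleRel s n m)) := by
      ext a; simp [x, PresentedGroup.of]
    rw [this]
    exact PresentedGroup.one_of_mem ⟨i, rfl⟩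
  let ξ : Option (Fin s) → CocycleExt φ f hf := fun a => ⟨0, x a⟩
  have hξ : ∀ a, CocycleExt.proj (ξ a) = x a := fun _ => rfl
  have hξU : ∀ i, CocycleExt.proj (cycleU ξ i) = cycleU x i := by
    intro i
    unfold cycleU
    split_ifs
    · rfl
    · rfl
  have hb : ∀ i, ∃ b, CocycleExt.incl b * (cycleU ξ i * ξ (some i) ^ n i * (cycleU ξ i)⁻¹)
      = ξ (some (finRotate s i)) ^ m i := by
    intro i
    apply CocycleExt.exists_incl
    simp only [map_mul, map_inv, map_zpow, hξ, hξU]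
    exact hx i
  choose b hb using hb
  obtain ⟨c, d, hcd⟩ := cycle_solve (M := M) (finRotate s) (finRotate_trans s) i0
    (fun i => φ (x (some i))) (fun i => φ (cycleU x i)) n m hn hm hcop
    (fun i => by rw [← map_zpow, ← map_zpow, ← map_inv, ← map_mul, ← map_mul, hx])
    hp hM k hk b
  let η : Option (Fin s) → CocycleExt φ f hf := fun a =>
    CocycleExt.incl (a.elim d c) * ξ a
  have hη : ∀ i, FreeGroup.lift η (cycleRel s n m i) = 1 := by
    intro i
    rw [cycleRel_lift]
    have hU : cycleU η i = CocycleExt.incl (if i = i0 then d else 0) * cycleU ξ i := by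
      unfold cycleU
      by_cases h : (i : ℕ) + 1 < s
      · have h' : i ≠ i0 := fun h' => (hi0 i).1 h' h
        simp only [if_pos h, if_neg h', CocycleExt.incl_zero, one_mul]
      · have h' : i = i0 := (hi0 i).2 h
        rw [if_neg h, if_neg h, if_pos h']
        rfl
    rw [hU]
    apply CocycleExt.rel_of_eq (b := b i) (hb := hb i)
    rw [hξU, hξ, hξ]
    refine Eq.trans ?_ (hcd i)
    by_cases h : i = i0
    · simp only [if_pos h]; rfl
    · simp only [if_neg h, smul_zero, sub_zero]; rfl
  let S : GBSCycle s n m →* CocycleExt φ f hf := PresentedGroup.toGroup (f := η)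
    (by rintro _ ⟨i, rfl⟩; exact hη i)
  have hS : CocycleExt.proj.comp S = MonoidHom.id _ := by
    apply PresentedGroup.ext
    intro a
    simp only [MonoidHom.comp_apply, S, PresentedGroup.toGroup.of, η, map_mul,
      CocycleExt.proj_incl, one_mul, hξ, MonoidHom.id_apply]
    rfl
  have hS' : ∀ g, (S g).snd = g := fun g => DFunLike.congr_fun hS g
  refine ⟨fun g => - (S g).fst, fun g h => ?_⟩
  have := congrArg CocycleExt.fst (map_mul S g h)
  rw [CocycleExt.mul_fst, hS', hS'] at this
  simp only [this, smul_neg]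
  abel

end Presentation

/-- Paper's Lemma 3.5 (Vanishing): if the augmentation products `n(Ξ)` and `m(Ξ)` of the
cycle are coprime and `p` is a prime dividing `n(Ξ)·m(Ξ)`, then `H²(Γ, M)` vanishes for
every representation of `Γ` on a finite abelian group `M` of `p`-power order. -/
theorem GBSCycle_H2_vanishes_of_coprime
    (s : ℕ) (hs : 0 < s) (n m : Fin s → ℤ)
    (hn : ∀ i, n i ≠ 0) (hm : ∀ i, m i ≠ 0)
    (hcop : IsCoprime (∏ j, n j) (∏ j, m j))
    (p : ℕ) (hp : p.Prime) (hdvd : (p : ℤ) ∣ (∏ j, n j) * (∏ j, m j))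
    (M : Type) [AddCommGroup M] [Finite M] (hcard : ∃ k : ℕ, Nat.card M = p ^ k)
    (ρ : Representation ℤ (GBSCycle s n m) M) :
    Subsingleton (groupCohomology (Rep.of ρ) 2) := by
  have hnm : ∀ i j, IsCoprime (n i) (m j) := fun i j =>
    (hcop.of_isCoprime_of_dvd_left (Finset.dvd_prod_of_mem n (Finset.mem_univ i))
      ).of_isCoprime_of_dvd_right (Finset.dvd_prod_of_mem m (Finset.mem_univ j))
  have hpp := Nat.prime_iff_prime_int.1 hp
  obtain ⟨k, hk⟩ : ∃ k, (p : ℤ) ∣ n k ∨ (p : ℤ) ∣ m k := by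
    rcases hpp.dvd_or_dvd hdvd with h | h
    · obtain ⟨k, -, hk⟩ := (Prime.dvd_finsetProd_iff hpp n).1 h
      exact ⟨k, Or.inl hk⟩
    · obtain ⟨k, -, hk⟩ := (Prime.dvd_finsetProd_iff hpp m).1 h
      exact ⟨k, Or.inr hk⟩
  obtain ⟨r, hr⟩ := hcard
  have hM : ∀ x : M, (p ^ r) • x = 0 := fun x => by
    rw [← hr]; exact card_nsmul_eq_zero'
  have hfin : Finite (M →ₗ[ℤ] M) := DFunLike.finite _
  have hfin' : Finite (Module.End ℤ M)ˣ :=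
    Finite.of_injective (fun u => (u : M →ₗ[ℤ] M)) Units.val_injective
  let φ : GBSCycle s n m →* (Module.End ℤ M)ˣ := MonoidHom.toHomUnits ρ
  refine subsingleton_of_forall_eq 0 fun z => ?_
  induction z using groupCohomology.H2_induction_on with
  | h f =>
    rw [groupCohomology.H2π_eq_zero_iff]
    have hf := (groupCohomology.mem_cocycles₂_iff (A := Rep.of ρ) f).1 f.2
    obtain ⟨y, hy⟩ := GBSCycle_cocycle_split (M := M) s n m hs hn hm hnm hp hM k hk φ f hf
    exact ⟨y, funext fun gh => hy gh.1 gh.2⟩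
end

section
/- Let Γ = Γ((n_i),(m_i)) be a generalised Baumslag–Solitar group over a cycle of length s whose augmentation products n(Ξ) and m(Ξ) are isocratic but not coprime. Let p be a prime dividing n(Ξ)·m(Ξ) and let q be a prime dividing gcd(n(Ξ), m(Ξ)) (possibly q = p). Then there exists a representation ρ of Γ on the 𝔽_p-vector space (Fin q → ZMod p) ≅ 𝔽_p^q such that the second group cohomology H²(Γ, ρ) is nontrivial. -/
/-- Two integers are *isocratic* if every prime dividing both divides them with the same
`p`-adic valuation. -/
def Isocratic (a b : ℤ) : Prop :=
  ∀ p : ℕ, p.Prime → (p : ℤ) ∣ a → (p : ℤ) ∣ b →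
    padicValNat p a.natAbs = padicValNat p b.natAbs

/-- `d` is a derivation (crossed homomorphism) for the action of `F` through `π`. -/
def IsDer {k F G M : Type} [Field k] [Group F] [Group G] [AddCommGroup M] [Module k M]
    (π : F →* G) (ρ : Representation k G M) (d : F → M) : Prop :=
  ∀ w w', d (w * w') = d w + ρ (π w) (d w')

section der
variable {k F G M : Type} [Field k] [Group F] [Group G] [AddCommGroup M] [Module k M]
    {π : F →* G} {ρ : Representation k G M} {d : F → M}

lemma IsDer.one (h : IsDer π ρ d) : d 1 = 0 := by
  have := h 1 1
  simpa using this

lemma IsDer.inv (h : IsDer π ρ d) (w : F) : d w⁻¹ = - ρ (π w)⁻¹ (d w) := by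
  have := h w⁻¹ w
  rw [inv_mul_cancel, h.one, map_inv] at this
  exact eq_neg_of_add_eq_zero_left this.symm

lemma IsDer.mul_inv (h : IsDer π ρ d) {w w' : F} (hw : π w = π w') :
    d (w * w'⁻¹) = d w - d w' := by
  rw [h, h.inv, map_neg, hw, ← Module.End.mul_apply, ← map_mul]
  simp [sub_eq_add_neg]

lemma rep_zpow_trivial {g : G} (hg : ρ g = 1) (n : ℤ) : ρ (g ^ n) = 1 :=
  MonoidHom.mem_ker.1 ((MonoidHom.ker (ρ : G →* (M →ₗ[k] M))).zpow_mem (MonoidHom.mem_ker.2 hg) n)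

lemma IsDer.zpow_trivial (h : IsDer π ρ d) {a : F} (ha : ρ (π a) = 1) (n : ℤ) :
    d (a ^ n) = n • d a := by
  induction n with
  | zero => simp [h.one]
  | succ i ih =>
    rw [zpow_add, zpow_one, h, ih, map_zpow, rep_zpow_trivial ha]
    simp [add_smul]
  | pred i ih =>
    have e : a ^ (-(i:ℤ)) = a ^ (-(i:ℤ) - 1) * a := by rw [zpow_sub_one]; group
    rw [e, h, map_zpow, rep_zpow_trivial ha] at ih
    simp only [Module.End.one_apply] at ih
    rw [sub_smul, ← ih, one_smul]; abel

lemma IsDer.zpow_invariant (h : IsDer π ρ d) {a : F} {n : ℤ} (ha : ρ (π (a ^ n)) = 1) :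
    ρ (π a) (d (a ^ n)) = d (a ^ n) := by
  have h1 := h a (a ^ n)
  have h2 := h (a ^ n) a
  have e : a * a ^ n = a ^ n * a := by group
  rw [e, h2, ha] at h1
  simp only [Module.End.one_apply] at h1
  rw [add_comm] at h1
  exact (add_left_cancel h1).symm

lemma IsDer.zpow_principal (h : IsDer π ρ d) {a : F} {v : M} (hv : d a = v - ρ (π a) v)
    (n : ℤ) : d (a ^ n) = v - ρ (π a ^ n) v := by
  induction n with
  | zero => simp [h.one]
  | succ i ih =>
    rw [zpow_add, zpow_one, h, ih, hv, map_zpow π, zpow_add, zpow_one, map_mul]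
    simp only [map_sub, Module.End.mul_apply]; abel
  | pred i ih =>
    have e : a ^ (-(i:ℤ)) = a ^ (-(i:ℤ) - 1) * a := by rw [zpow_sub_one]; group
    have e' : π a ^ (-(i:ℤ)) = π a ^ (-(i:ℤ) - 1) * π a := by rw [zpow_sub_one]; group
    rw [e, h, hv, map_zpow π, e', map_mul] at ih
    simp only [map_sub, Module.End.mul_apply] at ih
    rw [← sub_eq_zero] at ih ⊢
    rw [← ih]; abel

/-- Existence of derivations on a free group with prescribed values. -/
lemma exists_isDer {α : Type} (π : FreeGroup α →* G) (ρ : Representation k G M) (e : α → M) :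
    ∃ d : FreeGroup α → M, IsDer π ρ d ∧ ∀ x, d (FreeGroup.of x) = e x := by
  let Φ : FreeGroup α →* Equiv.Perm M := FreeGroup.lift fun x =>
    { toFun := fun b => ρ (π (FreeGroup.of x)) b + e x
      invFun := fun b => ρ (π (FreeGroup.of x))⁻¹ (b - e x)
      left_inv := fun b => by simp
      right_inv := fun b => by simp }
  have hof : ∀ x b, Φ (FreeGroup.of x) b = ρ (π (FreeGroup.of x)) b + e x := by
    intro x b; simp [Φ]
  have key : ∀ w b, Φ w b = ρ (π w) b + Φ w 0 := by
    intro w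
    induction w using FreeGroup.induction_on with
    | C1 => simp
    | of x => intro b; rw [hof, hof]; simp
    | inv_of x ih =>
      intro b
      have h1 : Φ (FreeGroup.of x) (Φ (FreeGroup.of x)⁻¹ b) = b := by simp
      have h2 : Φ (FreeGroup.of x) (Φ (FreeGroup.of x)⁻¹ 0) = 0 := by simp
      rw [hof] at h1 h2
      have h3 : ρ (π (FreeGroup.of x)) (Φ (FreeGroup.of x)⁻¹ b - Φ (FreeGroup.of x)⁻¹ 0) = b := by
        rw [map_sub]
        rw [← eq_sub_iff_add_eq] at h1 h2
        rw [h1, h2]; abel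
      have h4 := congrArg (ρ (π (FreeGroup.of x)⁻¹)) h3
      rw [map_inv, Representation.inv_self_apply] at h4
      rw [map_inv π, ← h4]; abel
    | mul u v hu hv =>
      intro b
      rw [map_mul, Equiv.Perm.mul_apply, Equiv.Perm.mul_apply, hu, hv b, hu (Φ v 0), map_mul, map_add]
      simp [add_assoc]
  refine ⟨fun w => Φ w 0, ?_, ?_⟩
  · intro w w'
    show Φ (w * w') 0 = _
    rw [map_mul, Equiv.Perm.mul_apply, key w (Φ w' 0), add_comm]
  · intro x; show Φ _ 0 = _; rw [hof]; simp
end der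

/-- If `H²` vanishes, a derivation of the free group to `B ⊇ M` which maps relators to `M`
can be corrected to one with values in `M`. -/
lemma exists_der_of_H2 {k α M B : Type} [Field k] [AddCommGroup M] [Module k M]
    [AddCommGroup B] [Module k B] (rels : Set (FreeGroup α))
    (ρ : Representation k (PresentedGroup rels) M) (τ : Representation k (PresentedGroup rels) B)
    (ι : M →ₗ[k] B) (hι : Function.Injective ι) (heq : ∀ g v, ι (ρ g v) = τ g (ι v))
    (d : FreeGroup α → B) (hd : IsDer (PresentedGroup.mk rels) τ d)
    (hrel : ∀ r ∈ rels, ∃ c, ι c = d r)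
    (H : Subsingleton (groupCohomology (Rep.of ρ) 2)) :
    ∃ δ : FreeGroup α → M, IsDer (PresentedGroup.mk rels) ρ δ ∧ ∀ r ∈ rels, ι (δ r) = d r := by
  set π := PresentedGroup.mk rels with hπ
  have hR : ∀ w, π w = 1 → ∃ c, ι c = d w := by
    let K : Subgroup (FreeGroup α) :=
      { carrier := {w | π w = 1 ∧ ∃ c, ι c = d w}
        one_mem' := ⟨map_one _, 0, by rw [hd.one, map_zero]⟩
        mul_mem' := by
          rintro a b ⟨ha, c, hc⟩ ⟨hb, c', hc'⟩
          refine ⟨by rw [map_mul, ha, hb, one_mul], c + c', ?_⟩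
          rw [hd, ha, map_add, hc, hc']; simp
        inv_mem' := by
          rintro a ⟨ha, c, hc⟩
          refine ⟨by rw [map_inv, ha, inv_one], -c, ?_⟩
          rw [hd.inv, ha, map_neg, hc]; simp }
    have hK : K.Normal := by
      constructor
      rintro a ⟨ha, c, hc⟩ g
      have e : π (g * a) = π g := by rw [map_mul, ha, mul_one]
      refine ⟨by rw [map_mul, e, map_inv, mul_inv_cancel], ρ (π g) c, ?_⟩
      rw [hd.mul_inv e, hd, heq, hc]; abel
    have hle : Subgroup.normalClosure rels ≤ K := Subgroup.normalClosure_le_normal fun r hr =>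
      ⟨PresentedGroup.one_of_mem hr, hrel r hr⟩
    intro w hw
    exact (hle (PresentedGroup.mk_eq_one_iff.1 hw)).2
  obtain ⟨σ, hσ⟩ := (PresentedGroup.mk_surjective rels).hasRightInverse
  have hσ' : ∀ g, π (σ g) = g := hσ
  have hex : ∀ x : PresentedGroup rels × PresentedGroup rels, ∃ c, ι c =
      τ x.1 (d (σ x.2)) - d (σ (x.1 * x.2)) + d (σ x.1) := by
    rintro ⟨g, h⟩
    have e : π (σ g * σ h) = π (σ (g * h)) := by rw [map_mul, hσ', hσ', hσ']
    obtain ⟨c, hc⟩ := hR (σ g * σ h * (σ (g * h))⁻¹) (by rw [map_mul, e, map_inv, mul_inv_cancel])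
    refine ⟨c, ?_⟩
    rw [hc, hd.mul_inv e, hd, hσ']
    simp only; abel
  choose f hf using hex
  have hcoc : f ∈ groupCohomology.cocycles₂ (Rep.of ρ) := by
    rw [groupCohomology.mem_cocycles₂_def]
    intro g h j
    apply hι
    show ι (ρ g (f (h, j)) - f (g * h, j) + f (g, h * j) - f (g, h)) = ι 0
    simp only [map_sub, map_add, map_zero, heq, hf, map_mul, mul_assoc, Module.End.mul_apply]
    abel
  have hz : groupCohomology.H2π (Rep.of ρ) ⟨f, hcoc⟩ = 0 := @Subsingleton.elim _ H _ _
  rw [groupCohomology.H2π_eq_zero_iff] at hz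
  obtain ⟨β, hβ⟩ := hz
  have hβ' : ∀ g h, ρ g (β h) - β (g * h) + β g = f (g, h) := fun g h => congrFun hβ (g, h)
  -- the derivation `D` on the group
  have hex2 : ∀ w, ∃ c, ι c = d w - (d (σ (π w)) - ι (β (π w))) := by
    intro w
    have e : π w = π (σ (π w)) := by rw [hσ']
    obtain ⟨c, hc⟩ := hR (w * (σ (π w))⁻¹) (by rw [map_mul, map_inv, ← e, mul_inv_cancel])
    rw [hd.mul_inv e] at hc
    exact ⟨c + β (π w), by rw [map_add, hc]; abel⟩
  choose δ hδ using hex2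
  have hD : ∀ g h, d (σ (g * h)) - ι (β (g * h)) =
      d (σ g) - ι (β g) + τ g (d (σ h) - ι (β h)) := by
    intro g h
    have := congrArg ι (hβ' g h)
    rw [hf] at this
    simp only [map_sub, map_add, heq] at this ⊢
    rw [← sub_eq_zero] at this ⊢
    rw [← this]; abel
  refine ⟨δ, ?_, ?_⟩
  · intro w w'
    apply hι
    rw [map_add, heq, hδ, hδ, hδ, map_mul, hD, hd]
    simp only [map_sub]
    abel
  · intro r hr
    have h1 : π r = 1 := PresentedGroup.one_of_mem hr
    have h2 := hD 1 1
    simp only [mul_one, map_one, Module.End.one_apply] at h2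
    rw [hδ, h1]
    have h3 : d (σ 1) - ι (β 1) = 0 := by
      have := left_eq_add.1 h2
      exact this
    rw [h3, sub_zero]

/-- Coinduced representation on functions. -/
def coindFun {k G M : Type} [Field k] [Group G] [AddCommGroup M] [Module k M] :
    Representation k G (G → M) where
  toFun h := { toFun := fun f g => f (g * h), map_add' := fun _ _ => rfl, map_smul' := fun _ _ => rfl }
  map_one' := by ext; simp
  map_mul' x y := by ext; simp [mul_assoc]

lemma exists_int_primitive {M : Type} [AddCommGroup M] (f : ℤ → M) :
    ∃ S : ℤ → M, ∀ n, S n - S (n + 1) = f n := by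
  refine ⟨fun n => match n with
    | Int.ofNat n => - ∑ i ∈ Finset.range n, f i
    | Int.negSucc n => ∑ i ∈ Finset.range (n + 1), f (Int.negSucc i), ?_⟩
  intro n
  match n with
  | Int.ofNat n =>
    show - ∑ i ∈ Finset.range n, f i - - ∑ i ∈ Finset.range (n+1), f i = f n
    rw [Finset.sum_range_succ]; abel
  | Int.negSucc 0 =>
    show ∑ i ∈ Finset.range (0 + 1), f (Int.negSucc i) - - ∑ i ∈ Finset.range 0, f i = _
    simp
  | Int.negSucc (n+1) =>
    show ∑ i ∈ Finset.range (n + 1 + 1), f (Int.negSucc i) -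
      ∑ i ∈ Finset.range (n + 1), f (Int.negSucc i) = _
    rw [Finset.sum_range_succ]; abel

lemma coindFun_surj {k G M : Type} [Field k] [Group G] [AddCommGroup M] [Module k M]
    (h : G) (hh : ∀ n : ℤ, h ^ n = 1 → n = 0) (b : G → M) :
    ∃ v : G → M, v - coindFun (k := k) h v = b := by
  let H := Subgroup.zpowers h
  let r : G → G := fun g => (Quotient.out (QuotientGroup.mk g : G ⧸ H))
  have hr : ∀ g, ∃ n : ℤ, r g * h ^ n = g := by
    intro g
    have : (QuotientGroup.mk (r g) : G ⧸ H) = QuotientGroup.mk g := Quotient.out_eq _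
    rw [QuotientGroup.eq] at this
    obtain ⟨n, hn⟩ := this
    exact ⟨n, by simp only at hn; rw [hn]; group⟩
  choose N hN using hr
  have hrh : ∀ g, r (g * h) = r g := by
    intro g
    have : (QuotientGroup.mk (g * h) : G ⧸ H) = QuotientGroup.mk g := by
      rw [eq_comm, QuotientGroup.eq]; exact ⟨1, by simp⟩
    simp only [r, this]
  have hNh : ∀ g, N (g * h) = N g + 1 := by
    intro g
    have h1 := hN (g * h)
    rw [hrh] at h1
    have h2 : r g * h ^ (N g + 1) = g * h := by rw [zpow_add_one, ← mul_assoc, hN]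
    replace h1 := mul_left_cancel (h1.trans h2.symm)
    have := hh (N (g * h) - (N g + 1)) (by rw [zpow_sub, h1, mul_inv_cancel])
    omega
  choose S hS using fun x : G => exists_int_primitive (fun n => b (x * h ^ n))
  refine ⟨fun g => S (r g) (N g), ?_⟩
  ext g
  show S (r g) (N g) - S (r (g * h)) (N (g * h)) = b g
  rw [hrh, hNh, hS, hN]

/-- Cyclic successor. -/
def nx {s : ℕ} (i : Fin s) : Fin s := if h : (i : ℕ) + 1 < s then ⟨(i : ℕ) + 1, h⟩ else ⟨0, i.pos⟩

lemma nx_eq {k : ℕ} (i : Fin (k + 1)) : nx i = i + 1 := by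
  unfold nx
  split_ifs with h
  · ext; simp only [Fin.val_add_one]; split_ifs with h'
    · subst h'; simp at h
    · rfl
  · have : i = Fin.last k := by ext; simp; omega
    subst this; simp

/-- Stable letter in the relator (trivial except for the last one). -/
def cycT (s : ℕ) (i : Fin s) : FreeGroup (Option (Fin s)) :=
  if (i : ℕ) + 1 < s then 1 else FreeGroup.of none

lemma cycleRel_eq (s : ℕ) (n m : Fin s → ℤ) (i : Fin s) :
    cycleRel s n m i = (cycT s i * FreeGroup.of (some i) ^ (n i) * (cycT s i)⁻¹) *
      (FreeGroup.of (some (nx i)) ^ (m i))⁻¹ := by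
  unfold cycleRel cycT nx
  split_ifs with h
  · simp
  · rw [zpow_neg]

section
variable {s : ℕ} {n m : Fin s → ℤ}

local notation "πΓ" => PresentedGroup.mk (Set.range (cycleRel s n m))

lemma cycle_rel_mk (i : Fin s) : πΓ (cycT s i * FreeGroup.of (some i) ^ (n i) * (cycT s i)⁻¹) =
      πΓ (FreeGroup.of (some (nx i)) ^ (m i)) := by
  have h : πΓ (cycleRel s n m i) = 1 := PresentedGroup.one_of_mem ⟨i, rfl⟩
  rw [cycleRel_eq, map_mul, map_inv] at h
  exact mul_inv_eq_one.1 h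

lemma der_rel {k M : Type} [Field k] [AddCommGroup M] [Module k M]
    {ρ : Representation k (GBSCycle s n m) M} {d : FreeGroup (Option (Fin s)) → M}
    (hd : IsDer πΓ ρ d) (i : Fin s) :
    d (cycleRel s n m i) = d (cycT s i) + ρ (πΓ (cycT s i)) (d (FreeGroup.of (some i) ^ (n i)))
      - ρ (πΓ (FreeGroup.of (some (nx i)) ^ (m i))) (d (cycT s i))
      - d (FreeGroup.of (some (nx i)) ^ (m i)) := by
  rw [cycleRel_eq, hd.mul_inv (cycle_rel_mk i)]
  congr 1
  have h := cycle_rel_mk (n := n) (m := m) i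
  rw [map_mul, map_mul, map_inv] at h
  rw [← h, hd, hd, hd.inv, map_neg, sub_eq_add_neg]
  simp only [map_mul, Module.End.mul_apply]

/-- Universal property. -/
lemma exists_hom {H : Type} [Group H] (x : Fin s → H) (t : H)
    (h : ∀ i : Fin s, (if (i : ℕ) + 1 < s then 1 else t) * x i ^ n i *
      (if (i : ℕ) + 1 < s then 1 else t)⁻¹ = x (nx i) ^ m i) :
    ∃ φ : GBSCycle s n m →* H, (∀ i, φ (πΓ (FreeGroup.of (some i))) = x i) ∧
      φ (πΓ (FreeGroup.of none)) = t := by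
  let f : Option (Fin s) → H := fun o => o.elim t x
  have hf : ∀ r ∈ Set.range (cycleRel s n m), FreeGroup.lift f r = 1 := by
    rintro _ ⟨i, rfl⟩
    have e : FreeGroup.lift f (cycT s i) = if (i : ℕ) + 1 < s then 1 else t := by
      unfold cycT; split_ifs <;> simp [f]
    rw [cycleRel_eq, map_mul, map_inv, mul_inv_eq_one]
    simp only [map_mul, map_inv, map_zpow, e, FreeGroup.lift_apply_of]
    exact h i
  refine ⟨PresentedGroup.toGroup hf, fun i => ?_, ?_⟩
  · exact PresentedGroup.toGroup.of hf (x := some i)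
  · exact PresentedGroup.toGroup.of hf (x := none)

lemma perm_zpow_addRight (x : ℚ) (j : ℤ) :
    (Equiv.addRight x : Equiv.Perm ℚ) ^ j = Equiv.addRight (j • x) := by
  let φ : Multiplicative ℚ →* Equiv.Perm ℚ :=
    { toFun := fun y => Equiv.addRight y.toAdd
      map_one' := by ext; simp
      map_mul' := fun a b => by ext z; simp; ring }
  have h := map_zpow φ (Multiplicative.ofAdd x) j
  rw [← ofAdd_zsmul] at h
  exact h.symm

lemma a_inf_order (hn : ∀ i, n i ≠ 0) (hm : ∀ i, m i ≠ 0) (i : Fin s) (j : ℤ)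
    (h : πΓ (FreeGroup.of (some i)) ^ j = 1) : j = 0 := by
  let X : ℕ → ℚ := fun i => Nat.rec 1 (fun i y => if h : i < s then y * n ⟨i, h⟩ / m ⟨i, h⟩ else 1) i
  have hX : ∀ i, X (i + 1) = if h : i < s then X i * n ⟨i, h⟩ / m ⟨i, h⟩ else 1 := fun _ => rfl
  have hX0 : ∀ i, X i ≠ 0 := by
    intro i
    induction i with
    | zero => exact one_ne_zero
    | succ i ih =>
      rw [hX]; split_ifs with h
      · exact div_ne_zero (mul_ne_zero ih (by exact_mod_cast hn _)) (by exact_mod_cast hm _)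
      · exact one_ne_zero
  have hs : 0 < s := i.pos
  let l : Fin s := ⟨s - 1, by omega⟩
  let τ : ℚ := m l * X 0 / (n l * X (s - 1))
  have hτ : τ ≠ 0 := div_ne_zero (mul_ne_zero (by exact_mod_cast hm _) (hX0 0))
      (mul_ne_zero (by exact_mod_cast hn _) (hX0 _))
  obtain ⟨φ, hφ, -⟩ := exists_hom (n := n) (m := m) (H := Equiv.Perm ℚ)
    (fun i => Equiv.addRight (X i)) (Equiv.mulLeft₀ τ hτ) (by
      intro i
      rw [perm_zpow_addRight, perm_zpow_addRight]
      split_ifs with h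
      · have : ((nx i : Fin s) : ℕ) = i + 1 := by unfold nx; rw [dif_pos h]
        rw [this, hX, dif_pos i.2]
        have := hm i
        have h2 : (m i : ℚ) ≠ 0 := by exact_mod_cast this
        rw [one_mul, inv_one, mul_one]
        congr 1
        simp only [zsmul_eq_mul, Fin.eta]
        field_simp
      · have : ((nx i : Fin s) : ℕ) = 0 := by unfold nx; rw [dif_neg h]
        have hi : i = l := by ext; simp [l]; omega
        have hi' : (i : ℕ) = s - 1 := by omega
        rw [this, hi']
        have h1 : (n i : ℚ) ≠ 0 := by exact_mod_cast hn i
        have h2 := hX0 (s - 1)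
        rw [mul_inv_eq_iff_eq_mul]
        ext y
        simp only [Equiv.Perm.mul_apply, Equiv.coe_addRight, zsmul_eq_mul]
        change τ * (y + n i * X (s - 1)) = τ * y + m i * X 0
        rw [mul_add]
        congr 1
        simp only [τ, ← hi]
        field_simp)
  have h1 := congrArg φ h
  rw [map_zpow, hφ, perm_zpow_addRight, map_one] at h1
  have h2 := congrArg (fun e : Equiv.Perm ℚ => e 0) h1
  simp at h2
  exact h2.resolve_right (hX0 _)

lemma exists_solution {k M : Type} [Field k] [AddCommGroup M] [Module k M]
    (hn : ∀ i, n i ≠ 0) (hm : ∀ i, m i ≠ 0) (c : Fin s → GBSCycle s n m → M) :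
    ∃ d : FreeGroup (Option (Fin s)) → (GBSCycle s n m → M),
      IsDer πΓ (coindFun (k := k)) d ∧ ∀ i, d (cycleRel s n m i) = c i := by
  have surj : ∀ (i : Fin s) (j : ℤ) (hj : j ≠ 0) (b : GBSCycle s n m → M), ∃ v,
      v - coindFun (k := k) (πΓ (FreeGroup.of (some i)) ^ j) v = b := by
    intro i j hj b
    apply coindFun_surj
    intro r hr
    rw [← zpow_mul] at hr
    exact (mul_eq_zero.1 (a_inf_order hn hm i _ hr)).resolve_left hj
  choose S hS using surj
  let V : ℕ → (GBSCycle s n m → M) := fun i => Nat.rec 0 (fun i v => if h : i + 1 < s then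
    S ⟨i + 1, h⟩ (m ⟨i, by omega⟩) (hm _) (v - coindFun (k := k)
      (πΓ (FreeGroup.of (some ⟨i, by omega⟩)) ^ (n ⟨i, by omega⟩)) v - c ⟨i, by omega⟩) else 0) i
  have hV : ∀ i (h : i + 1 < s), V (i + 1) = S ⟨i + 1, h⟩ (m ⟨i, by omega⟩) (hm _)
      (V i - coindFun (k := k)
      (πΓ (FreeGroup.of (some ⟨i, by omega⟩)) ^ (n ⟨i, by omega⟩)) (V i) - c ⟨i, by omega⟩) := by
    intro i h
    show (if h : i + 1 < s then _ else _) = _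
    rw [dif_pos h]
  let et : GBSCycle s n m → M := if hs : 0 < s then
    S ⟨0, hs⟩ (m ⟨s - 1, by omega⟩) (hm _) (c ⟨s - 1, by omega⟩
      - coindFun (k := k) (πΓ (FreeGroup.of none)) (V (s - 1) - coindFun (k := k)
      (πΓ (FreeGroup.of (some ⟨s - 1, by omega⟩)) ^ (n ⟨s - 1, by omega⟩)) (V (s - 1)))
      + (V 0 - coindFun (k := k) (πΓ (FreeGroup.of (some ⟨0, hs⟩)) ^ (m ⟨s - 1, by omega⟩)) (V 0)))
    else 0
  obtain ⟨d, hd, hde⟩ := exists_isDer πΓ (coindFun (k := k)) (fun o : Option (Fin s) =>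
    o.elim et (fun i => V i - coindFun (k := k) (πΓ (FreeGroup.of (some i))) (V i)))
  refine ⟨d, hd, fun i => ?_⟩
  have hpow : ∀ (i : Fin s) (j : ℤ), d (FreeGroup.of (some i) ^ j) =
      V i - coindFun (k := k) (πΓ (FreeGroup.of (some i)) ^ j) (V i) := fun i j =>
    hd.zpow_principal (hde (some i)) j
  rw [der_rel hd, hpow, hpow]
  by_cases h : (i : ℕ) + 1 < s
  · have e1 : cycT s i = 1 := if_pos h
    have e2 : nx i = ⟨i + 1, h⟩ := dif_pos h
    rw [e1, hd.one, e2]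
    simp only [hV i h, hS]
    simp
  · have e1 : cycT s i = FreeGroup.of none := if_neg h
    have hs := i.pos
    have e2 : nx i = ⟨0, hs⟩ := dif_neg h
    obtain ⟨i, hi⟩ := i
    have hi' : i = s - 1 := by simp at h; omega
    subst hi'
    have e3 : d (FreeGroup.of none) = et := hde none
    have e4 := hS ⟨0, hs⟩ (m ⟨s - 1, by omega⟩) (hm _) (c ⟨s - 1, by omega⟩
      - coindFun (k := k) (πΓ (FreeGroup.of none)) (V (s - 1) - coindFun (k := k)
      (πΓ (FreeGroup.of (some ⟨s - 1, by omega⟩)) ^ (n ⟨s - 1, by omega⟩)) (V (s - 1)))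
      + (V 0 - coindFun (k := k) (πΓ (FreeGroup.of (some ⟨0, hs⟩)) ^ (m ⟨s - 1, by omega⟩)) (V 0)))
    have e5 : et = S ⟨0, hs⟩ (m ⟨s - 1, by omega⟩) (hm _) (c ⟨s - 1, by omega⟩
      - coindFun (k := k) (πΓ (FreeGroup.of none)) (V (s - 1) - coindFun (k := k)
      (πΓ (FreeGroup.of (some ⟨s - 1, by omega⟩)) ^ (n ⟨s - 1, by omega⟩)) (V (s - 1)))
      + (V 0 - coindFun (k := k) (πΓ (FreeGroup.of (some ⟨0, hs⟩)) ^ (m ⟨s - 1, by omega⟩)) (V 0))) :=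
      dif_pos hs
    rw [← e5] at e4
    rw [e1, e2, e3, map_zpow πΓ]
    simp only at e4 ⊢
    rw [add_sub_right_comm, e4]
    abel

/-- Criterion for nonvanishing of `H²`. -/
lemma H2_criterion {k M : Type} [Field k] [AddCommGroup M] [Module k M]
    (hn : ∀ i, n i ≠ 0) (hm : ∀ i, m i ≠ 0) (ρ : Representation k (GBSCycle s n m) M)
    (c : Fin s → M)
    (hc : ∀ d : FreeGroup (Option (Fin s)) → M, IsDer πΓ ρ d → ∃ i, d (cycleRel s n m i) ≠ c i) :
    ¬ Subsingleton (groupCohomology (Rep.of ρ) 2) := by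
  intro H
  let ι : M →ₗ[k] (GBSCycle s n m → M) :=
    { toFun := fun v g => ρ g v
      map_add' := fun _ _ => by ext; simp
      map_smul' := fun _ _ => by ext; simp }
  have hι : Function.Injective ι := by
    intro v w h
    have := congrFun h 1
    simpa [ι] using this
  obtain ⟨d, hd, hdc⟩ := exists_solution (k := k) hn hm (fun i => ι (c i))
  obtain ⟨δ, hδ, hδr⟩ := exists_der_of_H2 _ ρ coindFun ι hι (by
    intro g v; ext h; simp [ι, coindFun]) d hd (by
    rintro _ ⟨i, rfl⟩; exact ⟨c i, (hdc i).symm⟩) H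
  obtain ⟨i, hi⟩ := hc δ hδ
  exact hi (hι ((hδr _ ⟨i, rfl⟩).trans (hdc i)))
end

open Fin.NatCast in
lemma fin_orbit {k : ℕ} (P : Fin (k + 1) → Prop) (c : Fin (k + 1)) (h0 : P c)
    (h1 : ∀ i, P i → P (i + 1)) (e : Fin (k + 1)) : P e := by
  have key : ∀ r : ℕ, P (c + (r : Fin (k + 1))) := by
    intro r
    induction r with
    | zero => simpa using h0
    | succ r ih =>
      have := h1 _ ih
      rwa [add_assoc, ← Nat.cast_succ] at this
  have := key ((e - c : Fin (k + 1)) : ℕ)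
  rw [Fin.cast_val_eq_self] at this
  simpa using this

lemma exists_cycle_solution {K : Type} [Field K] {k : ℕ} (N M : Fin (k + 1) → K)
    (c e : Fin (k + 1)) (hc : N c = 0) (he : M e = 0) :
    ∃ x : Fin (k + 1) → K, x ≠ 0 ∧ ∀ i, N i * x i = M i * x (i + 1) := by
  let A : Matrix (Fin (k + 1)) (Fin (k + 1)) K := Matrix.of fun i j =>
    (if j = i then N i else 0) - (if j = i + 1 then M i else 0)
  have hA : ∀ i j, A i j = (if j = i then N i else 0) - (if j = i + 1 then M i else 0) :=
    fun _ _ => rfl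
  have hdet : A.det = 0 := by
    rw [← Matrix.det_transpose, Matrix.det_apply]
    refine Finset.sum_eq_zero fun σ _ => ?_
    have : ∏ i, Matrix.transpose A (σ i) i = 0 := by
      by_contra hne
      rw [← ne_eq, Finset.prod_ne_zero_iff] at hne
      have hne' : ∀ i, (σ i = i ∧ N i ≠ 0) ∨ (σ i = i + 1 ∧ M i ≠ 0) := by
        intro i
        have h := hne i (Finset.mem_univ _)
        rw [Matrix.transpose_apply, hA] at h
        by_contra hcon
        push Not at hcon
        apply h
        rw [show (if σ i = i then N i else 0) = 0 by
            split_ifs with h1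
            · exact hcon.1 h1
            · rfl,
          show (if σ i = i + 1 then M i else 0) = 0 by
            split_ifs with h1
            · exact hcon.2 h1
            · rfl, sub_zero]
      have hall := fin_orbit (fun i => σ i = i + 1 ∧ M i ≠ 0) c (by
          rcases hne' c with h | h
          · exact absurd hc h.2
          · exact h) (by
          rintro i ⟨h1, h2⟩
          rcases hne' (i + 1) with h | h
          · have : i + 1 = i := σ.injective (h.1.trans h1.symm)
            rw [this]; exact ⟨h1, h2⟩
          · exact h) e
      exact hall.2 he
    rw [this, smul_zero]
  obtain ⟨x, hx, hx'⟩ := Matrix.exists_mulVec_eq_zero_iff.2 hdet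
  refine ⟨x, hx, fun i => ?_⟩
  have := congrFun hx' i
  simp only [Matrix.mulVec, dotProduct, hA, sub_mul, ite_mul, zero_mul, Finset.sum_sub_distrib,
    Finset.sum_ite_eq', Finset.sum_ite_eq, Finset.mem_univ, if_true, Pi.zero_apply] at this
  exact sub_eq_zero.1 this

lemma exists_psi {K L : Type} [Field K] [Field L] {k : ℕ} (N M x : Fin (k + 1) → K)
    (N' M' : Fin (k + 1) → L) (c : Fin (k + 1)) (hc : N c = 0) (hx : x ≠ 0)
    (hsol : ∀ i, N i * x i = M i * x (i + 1)) :
    ∃ ψ : Fin (k + 1) → L, ψ ≠ 0 ∧ (∀ i, N i * x i ≠ 0 → ψ i = 0) ∧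
      ∀ i, x (i + 1) = 0 → N' (i + 1) * ψ (i + 1) = M' i * ψ i := by
  classical
  have hex : ∃ i, x i ≠ 0 ∧ N i * x i = 0 := by
    by_contra hcon
    push Not at hcon
    obtain ⟨j, hj⟩ := Function.ne_iff.1 hx
    have := fin_orbit (fun i => x i ≠ 0) j hj (fun i hi h0 => by
      apply hcon i hi; rw [hsol, h0, mul_zero]) c
    exact hcon c this (by rw [hc, zero_mul])
  obtain ⟨j, hj, hj'⟩ := hex
  let T : (Fin (k + 1) → L) →ₗ[L] (Fin (k + 1) → L) :=
    { toFun := fun ψ i => if x i = 0 then N' i * ψ i - M' (i - 1) * ψ (i - 1) else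
        if N i * x i ≠ 0 then ψ i else 0
      map_add' := fun a b => by
        ext i; simp only [Pi.add_apply]; split_ifs <;> ring
      map_smul' := fun r a => by
        ext i; simp only [Pi.smul_apply, smul_eq_mul, RingHom.id_apply]; split_ifs <;> ring }
  have hT : ∀ ψ i, T ψ i = if x i = 0 then N' i * ψ i - M' (i - 1) * ψ (i - 1) else
        if N i * x i ≠ 0 then ψ i else 0 := fun _ _ => rfl
  have hns : ¬ Function.Injective T := by
    rw [LinearMap.injective_iff_surjective]
    intro h
    obtain ⟨ψ, hψ⟩ := h (fun _ => 1)
    have := congrFun hψ j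
    rw [hT, if_neg hj, if_neg (not_not.2 hj')] at this
    exact zero_ne_one this
  rw [← LinearMap.ker_eq_bot, Submodule.eq_bot_iff] at hns
  push Not at hns
  obtain ⟨ψ, hψ, hψ0⟩ := hns
  rw [LinearMap.mem_ker] at hψ
  refine ⟨ψ, hψ0, fun i hi => ?_, fun i hi => ?_⟩
  · have := congrFun hψ i
    rwa [hT, if_neg (right_ne_zero_of_mul hi), if_pos hi] at this
  · have := congrFun hψ (i + 1)
    rw [hT, if_pos hi, add_sub_cancel_right] at this
    exact sub_eq_zero.1 this

/-- Shift representation of `ℤ/q` on functions. -/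
def shiftRep (k : Type) [Field k] (q : ℕ) [NeZero q] :
    Representation k (Multiplicative (ZMod q)) (Fin q → k) where
  toFun g :=
    { toFun := fun v i => v ((ZMod.finEquiv q).symm (ZMod.finEquiv q i + g.toAdd))
      map_add' := fun _ _ => rfl
      map_smul' := fun _ _ => rfl }
  map_one' := by ext; simp
  map_mul' x y := by
    ext v i
    simp [add_assoc]

lemma shift_const {k : Type} [Field k] {q : ℕ} [Fact q.Prime]
    (g : Multiplicative (ZMod q)) (hg : g.toAdd ≠ 0) (v : Fin q → k)
    (hv : shiftRep k q g v = v) (i j : Fin q) : v i = v j := by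
  have h1 : ∀ y : ZMod q, v ((ZMod.finEquiv q).symm (y + g.toAdd)) = v ((ZMod.finEquiv q).symm y) := by
    intro y
    have := congrFun hv ((ZMod.finEquiv q).symm y)
    change v ((ZMod.finEquiv q).symm (ZMod.finEquiv q ((ZMod.finEquiv q).symm y) + g.toAdd)) = _ at this
    rwa [RingEquiv.apply_symm_apply] at this
  have h2 : ∀ (r : ℕ) (y : ZMod q),
      v ((ZMod.finEquiv q).symm (y + r * g.toAdd)) = v ((ZMod.finEquiv q).symm y) := by
    intro r y
    induction r with
    | zero => simp
    | succ r ih => rw [← ih, ← h1 (y + r * g.toAdd)]; congr 2; push_cast; ring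
  have h3 := h2 (((ZMod.finEquiv q i - ZMod.finEquiv q j) * (g.toAdd)⁻¹ : ZMod q)).val
    (ZMod.finEquiv q j)
  rw [ZMod.natCast_zmod_val, mul_assoc, inv_mul_cancel₀ hg, mul_one] at h3
  simpa using h3

lemma GBS_main (k : ℕ) (n m : Fin (k + 1) → ℤ)
    (hn : ∀ i, n i ≠ 0) (hm : ∀ i, m i ≠ 0) (p q : ℕ) [Fact p.Prime] [Fact q.Prime]
    (c e : Fin (k + 1)) (hc : (n c : ZMod q) = 0) (he : (m e : ZMod q) = 0) :
    ∃ ρ : Representation (ZMod p) (GBSCycle (k + 1) n m) (Fin q → ZMod p),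
      ¬ Subsingleton (groupCohomology (Rep.of ρ) 2) := by
  classical
  obtain ⟨x, hx, hsol⟩ := exists_cycle_solution (fun i => (n i : ZMod q)) (fun i => (m i : ZMod q))
    c e hc he
  obtain ⟨ψ, hψ, hψ1, hψ2⟩ := exists_psi _ _ x (fun i => (n i : ZMod p)) (fun i => (m i : ZMod p))
    c hc hx hsol
  obtain ⟨χ, hχ, hχt⟩ := exists_hom (n := n) (m := m) (H := Multiplicative (ZMod q))
    (fun i => Multiplicative.ofAdd (x i)) 1 (by
      intro i
      rw [ite_self, one_mul, inv_one, mul_one, nx_eq, ← ofAdd_zsmul, ← ofAdd_zsmul]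
      congr 1
      rw [zsmul_eq_mul, zsmul_eq_mul]
      exact hsol i)
  let ρ : Representation (ZMod p) (GBSCycle (k + 1) n m) (Fin q → ZMod p) :=
    MonoidHom.comp (shiftRep (ZMod p) q) χ
  have hρ : ∀ g, ρ g = shiftRep (ZMod p) q (χ g) := fun _ => rfl
  have hρ1 : ∀ g, χ g = 1 → ρ g = 1 := fun g hg => by rw [hρ, hg, map_one]
  refine ⟨ρ, ?_⟩
  obtain ⟨i0, hi0⟩ := Function.ne_iff.1 hψ
  have hq2 : 1 < q := (Fact.out : q.Prime).one_lt
  let z : Fin q := ⟨0, by omega⟩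
  let o : Fin q := ⟨1, hq2⟩
  have hzo : o ≠ z := by simp [z, o]
  refine H2_criterion hn hm ρ (Pi.single i0 (Pi.single z 1)) ?_
  intro d hd
  by_contra hcon
  push Not at hcon
  set π := PresentedGroup.mk (Set.range (cycleRel (k + 1) n m)) with hπ
  let lam : (Fin q → ZMod p) → ZMod p := fun v => v z - v o
  let a : Fin (k + 1) → FreeGroup (Option (Fin (k + 1))) := fun i => FreeGroup.of (some i)
  let y : Fin (k + 1) → ZMod p := fun i => if x i = 0 then lam (d (a i)) else 0
  have hχa : ∀ i, χ (π (a i)) = Multiplicative.ofAdd (x i) := hχ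
  have hχap : ∀ i (j : ℤ), χ (π (a i ^ j)) = Multiplicative.ofAdd ((j : ZMod q) * x i) := by
    intro i j
    rw [map_zpow, map_zpow, hχa, ← ofAdd_zsmul, zsmul_eq_mul]
  have hpow : ∀ i (j : ℤ), (j : ZMod q) * x i = 0 → lam (d (a i ^ j)) = j * y i := by
    intro i j hj
    by_cases hxi : x i = 0
    · have h1 : ρ (π (a i)) = 1 := hρ1 _ (by rw [hχa, hxi]; rfl)
      rw [hd.zpow_trivial h1]
      simp only [y, if_pos hxi, lam, Pi.smul_apply]
      rw [zsmul_eq_mul, zsmul_eq_mul]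
      ring
    · have h1 : ρ (π (a i ^ j)) = 1 := hρ1 _ (by rw [hχap, hj]; rfl)
      have h2 := hd.zpow_invariant h1
      rw [hρ, hχa] at h2
      have h3 := shift_const _ (by simpa using hxi) _ h2 z o
      simp only [y, if_neg hxi, lam, mul_zero, h3, sub_self]
  have hT : ∀ i, ρ (π (cycT (k + 1) i)) = 1 := by
    intro i
    apply hρ1
    unfold cycT
    split_ifs
    · simp
    · exact hχt
  have hrel : ∀ i, ψ i * lam (d (cycleRel (k + 1) n m i)) =
      ψ i * (n i * y i) - ψ i * (m i * y (i + 1)) := by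
    intro i
    by_cases hi : (n i : ZMod q) * x i = 0
    · have hi' : (m i : ZMod q) * x (i + 1) = 0 := (hsol i).symm.trans hi
      have h1 : ρ (π (a (i + 1) ^ (m i))) = 1 := hρ1 _ (by rw [hχap, hi']; rfl)
      have h2 : d (cycleRel (k + 1) n m i) = d (a i ^ n i) - d (a (i + 1) ^ m i) := by
        rw [der_rel hd, ← hπ, hT, nx_eq]
        change _ + _ - ρ (π (a (i + 1) ^ (m i))) _ - _ = _
        rw [h1]
        simp only [Module.End.one_apply, a]
        abel
      rw [h2, ← hpow i _ hi, ← hpow (i + 1) _ hi']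
      simp only [lam, Pi.sub_apply]
      ring
    · rw [hψ1 i hi]; ring
  have hsum : ∑ i, ψ i * lam (d (cycleRel (k + 1) n m i)) = 0 := by
    simp only [hrel, Finset.sum_sub_distrib]
    rw [sub_eq_zero, ← Equiv.sum_comp (Equiv.addRight (1 : Fin (k + 1)))]
    refine Finset.sum_congr rfl fun i _ => ?_
    simp only [Equiv.coe_addRight]
    by_cases hxi : x (i + 1) = 0
    · have := hψ2 i hxi
      linear_combination (y (i + 1)) * this
    · simp [y, hxi]
  rw [Finset.sum_eq_single i0] at hsum
  · rw [hcon i0] at hsum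
    simp only [lam, Pi.single_eq_same, Pi.single_eq_of_ne hzo, sub_zero, mul_one] at hsum
    exact hi0 hsum
  · intro j _ hj
    rw [hcon j, Pi.single_eq_of_ne hj]
    simp [lam]
  · simp


/-- Paper's Lemma 4.5 (FunnyModule): if the augmentation products `n(Ξ)` and `m(Ξ)` of
the cycle are isocratic but not coprime, `p` is a prime dividing `n(Ξ)·m(Ξ)` and `q` a
prime dividing `gcd(n(Ξ), m(Ξ))`, then there is a representation of `Γ` on `𝔽_p^q` with
nonvanishing second cohomology. -/
theorem GBSCycle_H2_nonvanishing_of_isocratic_not_coprime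
    (s : ℕ) (hs : 0 < s) (n m : Fin s → ℤ)
    (hn : ∀ i, n i ≠ 0) (hm : ∀ i, m i ≠ 0)
    (hiso : Isocratic (∏ j, n j) (∏ j, m j))
    (hncop : ¬ IsCoprime (∏ j, n j) (∏ j, m j))
    (p : ℕ) (hp : p.Prime) (hpdvd : (p : ℤ) ∣ (∏ j, n j) * (∏ j, m j))
    (q : ℕ) (hq : q.Prime) (hqdvd : q ∣ Int.gcd (∏ j, n j) (∏ j, m j)) :
    ∃ ρ : Representation (ZMod p) (GBSCycle s n m) (Fin q → ZMod p),
      ¬ Subsingleton (groupCohomology (Rep.of ρ) 2) := by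
  obtain ⟨k, rfl⟩ : ∃ k, s = k + 1 := ⟨s - 1, by omega⟩
  have := Fact.mk hp
  have := Fact.mk hq
  have h1 : (q : ℤ) ∣ ∏ j, n j := (Int.natCast_dvd_natCast.2 hqdvd).trans (Int.gcd_dvd_left ..)
  have h2 : (q : ℤ) ∣ ∏ j, m j := (Int.natCast_dvd_natCast.2 hqdvd).trans (Int.gcd_dvd_right ..)
  have hqp : Prime (q : ℤ) := Nat.prime_iff_prime_int.1 hq
  obtain ⟨c, -, hc⟩ := (Prime.dvd_finsetProd_iff hqp _).1 h1
  obtain ⟨e, -, he⟩ := (Prime.dvd_finsetProd_iff hqp _).1 h2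
  exact GBS_main k n m hn hm p q c e ((ZMod.intCast_zmod_eq_zero_iff_dvd _ _).2 hc)
    ((ZMod.intCast_zmod_eq_zero_iff_dvd _ _).2 he)
end

section
/- Let Γ = Γ((n_i),(m_i)) be a generalised Baumslag–Solitar group over a cycle of length s (all n_i, m_i nonzero integers). Then for every representation A of Γ over ℤ and every k ≥ 3, the group cohomology H^k(Γ, A) is trivial (a subsingleton). In other words, Γ has cohomological dimension at most 2. -/
namespace GBSAux

/-! ### The vertex generators have infinite order -/

theorem addLeft_zpow (q : ℚ) (k : ℤ) (x : ℚ) :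
    ((Equiv.addLeft q : Equiv.Perm ℚ) ^ k) x = k * q + x := by
  induction k using Int.induction_on generalizing x with
  | zero => simp
  | succ i ih =>
    rw [zpow_add_one, Equiv.Perm.mul_apply, ih]; simp; ring
  | pred i ih =>
    rw [zpow_sub_one, Equiv.Perm.mul_apply, ih]
    have : (Equiv.addLeft q : Equiv.Perm ℚ)⁻¹ x = -q + x := by
      rw [Equiv.Perm.inv_def]; simp
    rw [this]; push_cast; ring

/-- The translation lengths of the vertex generators in the affine action on `ℚ`. -/
def transl (s : ℕ) (n m : Fin s → ℤ) (i : ℕ) : ℚ :=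
  ∏ j ∈ Finset.range i, if h : j < s then (n ⟨j, h⟩ : ℚ) / m ⟨j, h⟩ else 1

theorem transl_ne_zero (s : ℕ) (n m : Fin s → ℤ) (hn : ∀ i, n i ≠ 0) (hm : ∀ i, m i ≠ 0)
    (i : ℕ) : transl s n m i ≠ 0 := by
  unfold transl
  refine Finset.prod_ne_zero_iff.2 fun j _ => ?_
  split_ifs with h
  · exact div_ne_zero (by exact_mod_cast hn _) (by exact_mod_cast hm _)
  · exact one_ne_zero

theorem transl_succ (s : ℕ) (n m : Fin s → ℤ) (hm : ∀ i, m i ≠ 0) (i : Fin s) :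
    (n i : ℚ) * transl s n m i = m i * transl s n m (i + 1) := by
  have : (m i : ℚ) ≠ 0 := by exact_mod_cast hm _
  unfold transl
  rw [Finset.prod_range_succ, dif_pos i.2]
  simp only [Fin.eta]
  field_simp

theorem a_infinite (s : ℕ) (n m : Fin s → ℤ) (hn : ∀ i, n i ≠ 0) (hm : ∀ i, m i ≠ 0)
    (i : Fin s) (k : ℤ) (h : GBSCycle.a s n m i ^ k = 1) : k = 0 := by
  let φ : Option (Fin s) → Equiv.Perm ℚ := fun o => match o with
    | none => Equiv.mulLeft₀ (transl s n m s)⁻¹ (inv_ne_zero (transl_ne_zero s n m hn hm s))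
    | some i => Equiv.addLeft (transl s n m i)
  have hφ : ∀ r ∈ Set.range (cycleRel s n m), FreeGroup.lift φ r = 1 := by
    rintro _ ⟨j, rfl⟩
    unfold cycleRel
    split_ifs with hj
    · simp only [map_mul, map_zpow, FreeGroup.lift_apply_of, φ]
      ext x
      rw [Equiv.Perm.mul_apply, addLeft_zpow, addLeft_zpow]
      have := transl_succ s n m hm j
      simp only [Equiv.Perm.one_apply]
      push_cast
      linarith
    · have hjs : (j : ℕ) + 1 = s := by have := j.2; omega
      simp only [map_mul, map_zpow, map_inv, FreeGroup.lift_apply_of, φ]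
      ext x
      have h1 := transl_succ s n m hm j
      rw [hjs] at h1
      have h2 := transl_ne_zero s n m hn hm s
      have h0 : transl s n m 0 = 1 := by simp [transl]
      have : ∀ y, (Equiv.mulLeft₀ (transl s n m s)⁻¹
          (inv_ne_zero (transl_ne_zero s n m hn hm s)))⁻¹ y = transl s n m s * y := by
        intro y
        rw [Equiv.Perm.inv_def, Equiv.symm_apply_eq]
        simp [h2]
      have h5 : ∀ y, (Equiv.mulLeft₀ (transl s n m s)⁻¹
          (inv_ne_zero (transl_ne_zero s n m hn hm s))) y = (transl s n m s)⁻¹ * y :=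
        fun y => rfl
      simp only [Equiv.Perm.mul_apply, addLeft_zpow, this, h5, h1, h0,
        Equiv.Perm.one_apply]
      field_simp
      push_cast
      ring
  have h3 := congrArg (PresentedGroup.toGroup hφ) h
  rw [map_zpow, map_one, PresentedGroup.toGroup.of] at h3
  have h4 := congrArg (fun e : Equiv.Perm ℚ => e 0) h3
  simp only [φ, addLeft_zpow, Equiv.Perm.one_apply, add_zero, mul_eq_zero] at h4
  rcases h4 with h4 | h4
  · exact_mod_cast h4
  · exact absurd h4 (transl_ne_zero s n m hn hm _)

/-! ### `c - 1` is surjective on coinduced modules -/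

theorem exists_int_primitive {M : Type*} [AddCommGroup M] (g : ℤ → M) :
    ∃ F : ℤ → M, ∀ k, F (k + 1) = F k + g k := by
  refine ⟨fun k => match k with
    | Int.ofNat n => ∑ i ∈ Finset.range n, g i
    | Int.negSucc n => - ∑ i ∈ Finset.range (n + 1), g (Int.negSucc i), fun k => ?_⟩
  match k with
  | Int.ofNat n =>
    exact Finset.sum_range_succ (fun i : ℕ => g i) n
  | Int.negSucc 0 =>
    change (0 : M) = _
    simp
  | Int.negSucc (n + 1) =>
    change - ∑ i ∈ Finset.range (n + 1), g (Int.negSucc i) =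
      - ∑ i ∈ Finset.range (n + 1 + 1), g (Int.negSucc i) + _
    rw [Finset.sum_range_succ _ (n + 1)]
    abel

theorem exists_primitive {G M : Type*} [Group G] [AddCommGroup M] (c : G)
    (hc : ∀ k : ℤ, c ^ k = 1 → k = 0) (y : G → M) :
    ∃ f : G → M, ∀ h, f (h * c) - f h = y h := by
  let H := Subgroup.zpowers c
  let q : G → G := fun h => (QuotientGroup.mk h : G ⧸ H).out
  have hq : ∀ h, ∃ k : ℤ, h = q h * c ^ k := fun h => by
    have : (QuotientGroup.mk (q h) : G ⧸ H) = QuotientGroup.mk h := Quotient.out_eq _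
    rw [QuotientGroup.eq, Subgroup.mem_zpowers_iff] at this
    obtain ⟨k, hk⟩ := this
    exact ⟨k, by rw [hk]; group⟩
  have hqc : ∀ h, q (h * c) = q h := fun h => by
    have : (QuotientGroup.mk (h * c) : G ⧸ H) = QuotientGroup.mk h := by
      rw [eq_comm, QuotientGroup.eq]; simp [H]
    simp only [q, this]
  choose e he using hq
  choose F hF using fun x : G => exists_int_primitive (fun k => y (x * c ^ k))
  refine ⟨fun h => F (q h) (e h), fun h => ?_⟩
  have h1 : e (h * c) = e h + 1 := by
    have h2 := he (h * c)
    rw [hqc] at h2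
    nth_rw 1 [he h] at h2
    have h3 : c ^ (e h + 1 - e (h * c)) = 1 := by
      rw [zpow_sub, zpow_add_one, mul_inv_eq_one]
      rw [mul_assoc] at h2
      exact mul_left_cancel h2
    have := hc _ h3
    omega
  simp only [hqc, h1, hF, ← he]
  abel

/-! ### Cocycles on the free group -/

section Cocycle
variable {R F G M : Type*} [CommRing R] [Group F] [Group G] [AddCommGroup M] [Module R M]
  (ρ : Representation R G M) (p : F →* G)

/-- `f` is a 1-cocycle on `F` with values in the `G`-module `M`, `F` acting through `p`. -/
def IsCoc (f : F → M) : Prop := ∀ x y, f (x * y) = ρ (p x) (f y) + f x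

variable {ρ p}

theorem IsCoc.one {f : F → M} (hf : IsCoc ρ p f) : f 1 = 0 := by
  have := hf 1 1
  simpa using this

theorem IsCoc.inv {f : F → M} (hf : IsCoc ρ p f) (x : F) : f x⁻¹ = - ρ (p x)⁻¹ (f x) := by
  have := hf x⁻¹ x
  rw [inv_mul_cancel, hf.one, map_inv] at this
  exact (neg_eq_of_add_eq_zero_right this.symm).symm

theorem IsCoc.sub {f g : F → M} (hf : IsCoc ρ p f) (hg : IsCoc ρ p g) :
    IsCoc ρ p (fun x => f x - g x) := fun x y => by
  simp only [hf x y, hg x y, map_sub]; abel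

theorem isCoc_principal (w : M) : IsCoc ρ p (fun x => ρ (p x) w - w) := fun x y => by
  simp

theorem IsCoc.zpow {f : F → M} (hf : IsCoc ρ p f) {x : F} {w : M} (h : f x = ρ (p x) w - w)
    (k : ℤ) : f (x ^ k) = ρ (p x ^ k) w - w := by
  let S : Subgroup F :=
    { carrier := {x | f x = ρ (p x) w - w}
      mul_mem' := fun {a b} ha hb => by
        simp only [Set.mem_ofPred_eq] at *
        rw [hf, ha, hb]; simp
      one_mem' := by simp [hf.one]
      inv_mem' := fun {a} ha => by
        simp only [Set.mem_ofPred_eq] at *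
        rw [hf.inv, ha]; simp }
  have : x ^ k ∈ S := S.zpow_mem (show x ∈ S from h) k
  simpa [S] using this

/-- The affine permutation `x ↦ g x + v`. -/
def aff (ρ : Representation R G M) (g : G) (v : M) : Equiv.Perm M where
  toFun x := ρ g x + v
  invFun x := ρ g⁻¹ (x - v)
  left_inv x := by simp
  right_inv x := by simp

theorem exists_coc {α : Type*} (p : FreeGroup α →* G) (v : α → M) :
    ∃ Φ : FreeGroup α →* Equiv.Perm M, (∀ x u, Φ x u = ρ (p x) u + Φ x 0) ∧
      (∀ i, Φ (FreeGroup.of i) 0 = v i) ∧ IsCoc ρ p (fun x => Φ x 0) := by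
  let Φ : FreeGroup α →* Equiv.Perm M :=
    FreeGroup.lift fun i => aff ρ (p (FreeGroup.of i)) (v i)
  have h1 : ∀ x u, Φ x u = ρ (p x) u + Φ x 0 := by
    intro x
    induction x using FreeGroup.induction_on with
    | C1 => simp
    | of i => simp [Φ, aff]
    | inv_of i _ => simp [Φ, aff, Equiv.Perm.inv_def, sub_eq_add_neg]
    | mul a b ha hb =>
      intro u
      rw [map_mul, Equiv.Perm.mul_apply, Equiv.Perm.mul_apply, hb u, ha, ha (Φ b 0)]
      simp [add_assoc]
  refine ⟨Φ, h1, fun i => by simp [Φ, aff], fun x y => ?_⟩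
  simp only [map_mul, Equiv.Perm.mul_apply]
  rw [h1]

theorem descend {α : Type*} {rels : Set (FreeGroup α)}
    {ρ : Representation R (PresentedGroup rels) M} {f : FreeGroup α → M}
    (hf : IsCoc ρ (PresentedGroup.mk rels) f) (h : ∀ r ∈ rels, f r = 0) :
    ∃ f' : PresentedGroup rels → M, (∀ x y, f' (x * y) = ρ x (f' y) + f' x) ∧
      ∀ x, f' (PresentedGroup.mk rels x) = f x := by
  obtain ⟨Φ, h1, h2, h3⟩ := exists_coc (ρ := ρ) (PresentedGroup.mk rels)
    (fun i => f (FreeGroup.of i))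
  have hΦ : ∀ x, Φ x 0 = f x := by
    intro x
    induction x using FreeGroup.induction_on with
    | C1 => rw [hf.one]; simp
    | of i => exact h2 i
    | inv_of i _ => rw [hf.inv, ← h2 i]; exact h3.inv _
    | mul a b ha hb => rw [hf, ← ha, ← hb]; exact h3 a b
  have hr : ∀ r ∈ rels, FreeGroup.lift (fun i => Φ (FreeGroup.of i)) r = 1 := by
    intro r hr
    have : FreeGroup.lift (fun i => Φ (FreeGroup.of i)) = Φ := by ext1; simp
    rw [this]
    ext u
    rw [h1, hΦ, h r hr, PresentedGroup.one_of_mem hr]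
    simp
  have hmk : ∀ x, PresentedGroup.toGroup hr (PresentedGroup.mk rels x) = Φ x := by
    have : (PresentedGroup.toGroup hr).comp (PresentedGroup.mk rels) = Φ := by
      ext1 i
      exact PresentedGroup.toGroup.of hr
    exact fun x => DFunLike.congr_fun this x
  refine ⟨fun g => PresentedGroup.toGroup hr g 0, fun x y => ?_, fun x => ?_⟩
  · obtain ⟨x, rfl⟩ := PresentedGroup.mk_surjective rels x
    obtain ⟨y, rfl⟩ := PresentedGroup.mk_surjective rels y
    rw [← map_mul]
    simp only [hmk, hΦ]
    exact hf x y
  · simp only [hmk, hΦ]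

end Cocycle

/-! ### Solving the relator equations -/

theorem mk_rel_lt (s : ℕ) (n m : Fin s → ℤ) (i : Fin s) (h : (i : ℕ) + 1 < s) :
    GBSCycle.a s n m i ^ n i = GBSCycle.a s n m ⟨i + 1, h⟩ ^ m i := by
  have := PresentedGroup.one_of_mem (rels := Set.range (cycleRel s n m)) ⟨i, rfl⟩
  rw [cycleRel, dif_pos h, map_mul, map_zpow, map_zpow, zpow_neg, mul_inv_eq_one] at this
  exact this

theorem mk_rel_last (s : ℕ) (n m : Fin s → ℤ) (i : Fin s) (h : ¬ (i : ℕ) + 1 < s) :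
    (PresentedGroup.of none : GBSCycle s n m) * GBSCycle.a s n m i ^ n i *
      (PresentedGroup.of none)⁻¹ = GBSCycle.a s n m ⟨0, i.pos⟩ ^ m i := by
  have := PresentedGroup.one_of_mem (rels := Set.range (cycleRel s n m)) ⟨i, rfl⟩
  rw [cycleRel, dif_neg h, map_mul, map_mul, map_mul, map_inv, map_zpow, map_zpow, zpow_neg,
    mul_inv_eq_one] at this
  exact this

theorem solve (s : ℕ) (n m : Fin s → ℤ) (hn : ∀ i, n i ≠ 0) (hm : ∀ i, m i ≠ 0)
    {R M : Type*} [CommRing R] [AddCommGroup M] [Module R M]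
    (ρ : Representation R (GBSCycle s n m) M)
    (hρ : ∀ c : GBSCycle s n m, (∀ k : ℤ, c ^ k = 1 → k = 0) → ∀ y, ∃ u, ρ c u - u = y)
    (y : Fin s → M) :
    ∃ f : FreeGroup (Option (Fin s)) → M,
      IsCoc ρ (PresentedGroup.mk (Set.range (cycleRel s n m))) f ∧
      ∀ i, f (cycleRel s n m i) = y i := by
  have hc : ∀ i, ∀ k : ℤ, (GBSCycle.a s n m i ^ n i) ^ k = 1 → k = 0 := fun i k hk => by
    rw [← zpow_mul] at hk
    exact (mul_eq_zero.1 (a_infinite s n m hn hm i _ hk)).resolve_left (hn i)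
  have hc' : ∀ i j, ∀ k : ℤ, (GBSCycle.a s n m j ^ m i) ^ k = 1 → k = 0 := fun i j k hk => by
    rw [← zpow_mul] at hk
    exact (mul_eq_zero.1 (a_infinite s n m hn hm j _ hk)).resolve_left (hm i)
  have hu1 : ∀ i : Fin s, ∃ u, ρ (GBSCycle.a s n m i ^ n i) u - u = y i :=
    fun i => hρ _ (hc i) _
  have hu2 : ∀ i : Fin s, ∃ u, ρ (GBSCycle.a s n m ⟨0, i.pos⟩ ^ m i) u - u = y i :=
    fun i => hρ _ (hc' i _) _
  choose u hu using hu1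
  choose u' hu' using hu2
  let w : ℕ → M := fun i => - ∑ j ∈ Finset.range i, if h : j < s then u ⟨j, h⟩ else 0
  have hw0 : w 0 = 0 := by simp [w]
  have hw : ∀ i : Fin s, w i - w (i + 1) = u i := fun i => by
    simp only [w]
    rw [Finset.sum_range_succ, dif_pos i.2]
    simp
  -- values on generators
  let T : GBSCycle s n m := PresentedGroup.of none
  let v : Option (Fin s) → M := fun o => match o with
    | none => if h : 0 < s then ρ T (w (s - 1)) - u' ⟨s - 1, by omega⟩ else 0
    | some i => ρ (GBSCycle.a s n m i) (w i) - w i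
  obtain ⟨Φ, -, hv, hf⟩ := exists_coc (ρ := ρ)
    (PresentedGroup.mk (Set.range (cycleRel s n m))) v
  generalize hfd : (fun x => Φ x 0) = f at hf
  refine ⟨f, hf, fun i => ?_⟩
  have hv' : ∀ o, f (FreeGroup.of o) = v o := fun o => by rw [← hfd]; exact hv o
  have ha : ∀ j (k : ℤ), f (FreeGroup.of (some j) ^ k) = ρ (GBSCycle.a s n m j ^ k) (w j) - w j :=
    fun j k => hf.zpow (hv' (some j)) k
  unfold cycleRel
  split_ifs with h
  · have hr := mk_rel_lt s n m i h
    rw [hf, ha, ha, map_zpow]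
    change ρ (GBSCycle.a s n m i ^ n i) _ + _ = _
    rw [← hu i, ← hw i, zpow_neg, ← hr]
    simp
    abel
  · have hr := mk_rel_last s n m i h
    have his : (i : ℕ) = s - 1 := by omega
    have hi : (⟨s - 1, by have := i.2; omega⟩ : Fin s) = i := Fin.ext his.symm
    have ht : f (FreeGroup.of none) = ρ T (w i) - u' i := by
      rw [hv']
      simp only [v]
      rw [dif_pos i.pos, hi, his]
    have hT : PresentedGroup.mk (Set.range (cycleRel s n m)) (FreeGroup.of none) = T := rfl
    rw [hf, ha, hf, hf, hf.inv, ha, ht, ← hu' i, ← hr]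
    simp only [map_mul, map_zpow, map_inv, hT, hw0, Module.End.mul_apply, map_zero, sub_zero,
      map_neg, map_sub, Representation.inv_self_apply]
    change 0 + (-(ρ T (ρ (GBSCycle.a s n m i ^ n i) _) -
      ρ T (ρ (GBSCycle.a s n m i ^ n i) (ρ T⁻¹ (u' i)))) + _) =
      ρ T (ρ (GBSCycle.a s n m i ^ n i) (ρ T⁻¹ (u' i))) - _
    abel


section Cat
open CategoryTheory CategoryTheory.Limits groupCohomology

variable {R G : Type} [CommRing R] [Group G] (A : Rep.{0} R G)

/-- The representation coinduced from the trivial subgroup. -/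
noncomputable abbrev co : Rep.{0} R G :=
  Rep.coind (⊥ : Subgroup G).subtype (Rep.res (⊥ : Subgroup G).subtype A)

/-- The embedding of a representation in a coinduced one. -/
noncomputable abbrev emb : A ⟶ co A :=
  Rep.resCoindToHom (⊥ : Subgroup G).subtype A (Rep.res (⊥ : Subgroup G).subtype A) (𝟙 _)

instance : Mono (emb A) := (Rep.mono_iff_injective _).2 fun x y h => by
  have := congrArg (fun z : co A => z.1 1) h
  simpa using this

/-- The short exact sequence `A → co A → coker`. -/
noncomputable abbrev ses : ShortComplex (Rep.{0} R G) :=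
  ShortComplex.mk (emb A) (cokernel.π (emb A)) (cokernel.condition _)

theorem ses_shortExact : (ses A).ShortExact where
  exact := ShortComplex.exact_cokernel _
  mono_f := inferInstanceAs (Mono (emb A))
  epi_g := inferInstanceAs (Epi (cokernel.π (emb A)))

theorem isZero_co (k : ℕ) : IsZero (groupCohomology (co A) (k + 1)) :=
  (isZero_groupCohomology_succ_of_subsingleton _ k).of_iso (coindIso _ _)

theorem shift (k : ℕ) (h : IsZero (groupCohomology (cokernel (emb A)) (k + 1))) :
    IsZero (groupCohomology A (k + 2)) := by
  have := epi_δ_of_isZero (ses_shortExact A) (k + 1) (isZero_co A (k + 1))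
  exact IsZero.of_epi (δ (ses_shortExact A) (k + 1) (k + 2) rfl) h

theorem co_surj (c : G) (hc : ∀ k : ℤ, c ^ k = 1 → k = 0) (y : co A) :
    ∃ u, (co A).ρ c u - u = y := by
  obtain ⟨f, hf⟩ := exists_primitive c hc y.1
  refine ⟨⟨f, fun g h => ?_⟩, Subtype.ext (funext fun h => hf h)⟩
  obtain rfl : g = 1 := Subsingleton.elim _ _
  simp

theorem ses_exact_apply (y : co A) (h : (cokernel.π (emb A)).hom y = 0) :
    ∃ x, (emb A).hom x = y := by
  have := (ses_shortExact A).exact.map (forget₂ (Rep.{0} R G) (ModuleCat.{0} R))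
  rw [ShortComplex.moduleCat_exact_iff] at this
  exact this y h

theorem ses_surj (z : (cokernel (emb A) : Rep R G)) : ∃ y, (cokernel.π (emb A)).hom y = z :=
  (Rep.epi_iff_surjective _).1 inferInstance z

end Cat

section Main
open CategoryTheory CategoryTheory.Limits groupCohomology

theorem H1_zero {R : Type} [CommRing R] (s : ℕ) (n m : Fin s → ℤ)
    (hn : ∀ i, n i ≠ 0) (hm : ∀ i, m i ≠ 0) (A : Rep.{0} R (GBSCycle s n m)) :
    IsZero (groupCohomology (cokernel (emb (cokernel (emb A)))) 1) := by
  set B : Rep.{0} R (GBSCycle s n m) := cokernel (emb A) with hB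
  set C : Rep.{0} R (GBSCycle s n m) := cokernel (emb B) with hC
  let π₀ : co A ⟶ B := cokernel.π (emb A)
  let π₁ : co B ⟶ C := cokernel.π (emb B)
  suffices Subsingleton (groupCohomology C 1) from ModuleCat.isZero_of_subsingleton _
  refine subsingleton_of_forall_eq 0 fun z => ?_
  induction z using H1_induction_on with | _ z =>
  rw [H1π_eq_zero_iff]
  have hz := (mem_cocycles₁_iff (A := C) z).1 z.2
  let p := PresentedGroup.mk (Set.range (cycleRel s n m))
  -- lift the cocycle to the free group
  choose v hv using fun o => ses_surj B (z (p (FreeGroup.of o)))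
  obtain ⟨Φ, -, h2, h3⟩ := exists_coc (ρ := (co B).ρ) p v
  have hΦ : ∀ x, π₁.hom (Φ x 0) = z (p x) := by
    have hz1 : IsCoc C.ρ p (fun x => z (p x)) := fun x y => by
      simp only [map_mul]; exact hz _ _
    have hz2 : IsCoc C.ρ p (fun x => π₁.hom (Φ x 0)) := fun x y => by
      have := h3 x y
      simp only at this ⊢
      rw [this, map_add, Rep.hom_comm_apply]
    intro x
    induction x using FreeGroup.induction_on with
    | C1 => exact hz2.one.trans hz1.one.symm
    | of i => rw [h2]; exact hv i
    | inv_of i h =>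
      refine (hz2.inv _).trans ((hz1.inv _).trans ?_).symm
      rw [h]
    | mul a b ha hb =>
      refine (hz2 a b).trans ((hz1 a b).trans ?_).symm
      simp only [ha, hb]
  have hb : ∀ i, ∃ b : B, (emb B).hom b = Φ (cycleRel s n m i) 0 := fun i => by
    refine ses_exact_apply B _ ((hΦ _).trans ?_)
    have : p (cycleRel s n m i) = 1 := PresentedGroup.one_of_mem ⟨i, rfl⟩
    rw [this]
    exact cocycles₁_map_one z
  choose b hb using hb
  choose y hy using fun i => ses_surj A (b i)
  obtain ⟨g, hg, hgy⟩ := solve s n m hn hm (co A).ρ (fun c hc y => co_surj A c hc y) y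
  have hg' : IsCoc (co B).ρ p (fun x => (emb B).hom (π₀.hom (g x))) := fun x y => by
    simp only
    rw [hg x y, map_add, map_add, Rep.hom_comm_apply, Rep.hom_comm_apply]
  obtain ⟨f, hf, hfx⟩ := descend (h3.sub hg') (by
    rintro _ ⟨i, rfl⟩
    simp only
    rw [hgy, ← hb, ← hy, sub_self])
  have hfz : ∀ x, π₁.hom (f x) = z x := by
    intro x
    obtain ⟨x, rfl⟩ := PresentedGroup.mk_surjective _ x
    rw [hfx, map_sub, hΦ]
    have : π₁.hom ((emb B).hom (π₀.hom (g x))) = 0 := by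
      have := congrArg (fun q : B ⟶ C => q.hom (π₀.hom (g x))) (cokernel.condition (emb B))
      exact this
    rw [this, sub_zero]
  -- `f` is a coboundary
  have hco : H1π (co B) ⟨f, (mem_cocycles₁_iff f).2 hf⟩ = 0 :=
    have := ModuleCat.subsingleton_of_isZero (isZero_co B 0)
    Subsingleton.elim _ _
  rw [H1π_eq_zero_iff] at hco
  obtain ⟨w, hw⟩ := hco
  refine ⟨π₁.hom w, funext fun x => ?_⟩
  rw [← hfz x]
  have := congrFun hw x
  change (co B).ρ x w - w = f x at this
  change C.ρ x (π₁.hom w) - π₁.hom w = _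
  rw [← this, map_sub, Rep.hom_comm_apply]

theorem Hk_zero {R : Type} [CommRing R] (s : ℕ) (n m : Fin s → ℤ)
    (hn : ∀ i, n i ≠ 0) (hm : ∀ i, m i ≠ 0) (k : ℕ) (A : Rep.{0} R (GBSCycle s n m)) :
    IsZero (groupCohomology A (k + 3)) := by
  induction k generalizing A with
  | zero => exact shift A 1 (shift _ 0 (H1_zero s n m hn hm A))
  | succ k ih => exact shift A (k + 2) (ih _)

end Main

end GBSAux

/-- Paper's Corollary 2.3 specialized to generalised Baumslag–Solitar groups over a
cycle: `Γ` has cohomological dimension at most 2, i.e. `H^k(Γ, A)` vanishes for every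
representation `A` of `Γ` over `ℤ` and every `k ≥ 3`. -/
theorem GBSCycle_cohomological_dimension_le_two
    (s : ℕ) (hs : 0 < s) (n m : Fin s → ℤ)
    (hn : ∀ i, n i ≠ 0) (hm : ∀ i, m i ≠ 0)
    (A : Rep ℤ (GBSCycle s n m)) (k : ℕ) (hk : 3 ≤ k) :
    Subsingleton (groupCohomology A k) := by
  obtain ⟨k, rfl⟩ := Nat.exists_eq_add_of_le' hk
  exact ModuleCat.subsingleton_of_isZero (GBSAux.Hk_zero s n m hn hm k A)
end
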